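/- arXiv:1904.08195 — 2 statements merged into one kernel-verified Lean document; each statement's English description precedes it below -/
import Mathlib

section
/- For real numbers a, b and α > 0, with α' = (1+α³)^{1/3}, the Airy function satisfies the convolution identity ∫_{-∞}^{∞} Ai(a+αx)·Ai(b−x) dx = (1/α')·Ai((a+αb)/α'). -/
open MeasureTheory Complex

/-- The Airy function, defined via the contour integral over the vertical line through 1. -/
noncomputable def Ai (x : ℝ) : ℝ :=
  ((2 * (Real.pi : ℂ) * Complex.I)⁻¹ *
    ∫ t : ℝ, Complex.exp ((1 + (t : ℂ) * Complex.I) ^ 3 / 3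
      - (x : ℂ) * (1 + (t : ℂ) * Complex.I)) * Complex.I).re

open scoped FourierTransform

/-- The integrand `exp (z³ / 3 - x z)` of the contour integral defining the Airy function. -/
noncomputable def airyKernel (x : ℝ) (z : ℂ) : ℂ := cexp (z ^ 3 / 3 - x * z)

lemma continuous_airyKernel (x : ℝ) : Continuous (airyKernel x) := by
  unfold airyKernel; fun_prop

lemma hasDerivAt_airyKernel (x : ℝ) (z : ℂ) :
    HasDerivAt (airyKernel x) ((z ^ 2 - x) * airyKernel x z) z := by
  have h : HasDerivAt (fun z : ℂ => z ^ 3 / 3 - x * z) (z ^ 2 - x) z := by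
    have h := ((hasDerivAt_pow 3 z).div_const 3).sub ((hasDerivAt_id z).const_mul (x : ℂ))
    rw [show z ^ 2 - (x : ℂ) = (3 : ℕ) * z ^ (3 - 1) / 3 - x * 1 by push_cast; ring]
    exact h
  rw [mul_comm]
  exact h.cexp

lemma norm_airyKernel (x c t : ℝ) :
    ‖airyKernel x (c + t * I)‖ = Real.exp (c ^ 3 / 3 - x * c) * Real.exp (-c * t ^ 2) := by
  rw [airyKernel, norm_exp, ← Real.exp_add]
  have : ((c : ℂ) + t * I) ^ 3 / 3 - x * (c + t * I) =
      ((c ^ 3 / 3 - x * c + -c * t ^ 2 : ℝ) : ℂ) +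
        ((c ^ 2 * t - t ^ 3 / 3 - x * t : ℝ) : ℂ) * I := by
    push_cast
    linear_combination ((c : ℂ) * t ^ 2 + t ^ 3 * I / 3) * I_sq
  rw [this, add_re, ofReal_re, re_ofReal_mul, I_re, mul_zero, add_zero]

/-- The integral of the Airy kernel along the vertical line through `c`. -/
noncomputable def airyLineIntegral (x c : ℝ) : ℂ := ∫ t : ℝ, airyKernel x (c + t * I)

lemma integrable_airyKernel (x : ℝ) {c : ℝ} (hc : 0 < c) :
    Integrable fun t : ℝ => airyKernel x (c + t * I) := by
  refine ((integrable_exp_neg_mul_sq hc).const_mul (Real.exp (c ^ 3 / 3 - x * c))).mono'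
    (Continuous.aestronglyMeasurable ?_) (.of_forall fun t => (norm_airyKernel x c t).le)
  exact (continuous_airyKernel x).comp (by fun_prop)

lemma norm_deriv_airyKernel_le (x t : ℝ) {c m M : ℝ} (hm : 0 < m) (hmc : m ≤ c) (hcM : c ≤ M) :
    ‖(((c : ℂ) + t * I) ^ 2 - x) * airyKernel x (c + t * I)‖ ≤
      (M ^ 2 + |x| + t ^ 2) * (Real.exp (M ^ 3 / 3 + |x| * M) * Real.exp (-m * t ^ 2)) := by
  have hc : 0 < c := hm.trans_le hmc
  rw [norm_mul, norm_airyKernel]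
  have h : ‖((c : ℂ) + t * I) ^ 2 - x‖ ≤ M ^ 2 + |x| + t ^ 2 := by
    calc ‖((c : ℂ) + t * I) ^ 2 - x‖ ≤ ‖((c : ℂ) + t * I) ^ 2‖ + ‖(x : ℂ)‖ := norm_sub_le _ _
      _ = c ^ 2 + t ^ 2 + |x| := by
        rw [norm_pow, Complex.sq_norm, normSq_add_mul_I, norm_real, Real.norm_eq_abs]
      _ ≤ M ^ 2 + |x| + t ^ 2 := by nlinarith
  have hx : -(x * c) ≤ |x| * M := by
    calc -(x * c) = -x * c := by ring
      _ ≤ |x| * c := by gcongr; exact neg_le_abs x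
      _ ≤ |x| * M := by gcongr
  have h3 : c ^ 3 ≤ M ^ 3 := by gcongr
  gcongr
  linarith

lemma integrable_const_add_sq_mul_exp_neg_mul_sq (A : ℝ) {b : ℝ} (hb : 0 < b) :
    Integrable fun t : ℝ => (A + t ^ 2) * Real.exp (-b * t ^ 2) := by
  have h := integrable_rpow_mul_exp_neg_mul_sq hb (s := 2) (by norm_num)
  simp only [Real.rpow_two] at h
  simp only [add_mul]
  exact ((integrable_exp_neg_mul_sq hb).const_mul A).add h

lemma hasDerivAt_airyLineIntegral (x : ℝ) {c : ℝ} (hc : 0 < c) :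
    HasDerivAt (airyLineIntegral x) 0 c := by
  have hline : ∀ c t : ℝ, HasDerivAt (fun c : ℝ => airyKernel x (c + t * I))
      ((((c : ℂ) + t * I) ^ 2 - x) * airyKernel x (c + t * I)) c := fun c t => by
    have h := (hasDerivAt_airyKernel x (c + t * I)).comp c
      ((hasDerivAt_id c).ofReal_comp.add_const ((t : ℂ) * I))
    simpa [Function.comp_def] using h
  have hvert : ∀ t : ℝ, HasDerivAt (fun t : ℝ => airyKernel x (c + t * I))
      (((((c : ℂ) + t * I) ^ 2 - x) * airyKernel x (c + t * I)) * I) t := fun t => by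
    have h := (hasDerivAt_airyKernel x (c + t * I)).comp t
      (((hasDerivAt_id t).ofReal_comp.mul_const I).const_add (c : ℂ))
    simpa [Function.comp_def] using h
  have hcont : Continuous fun t : ℝ => airyKernel x (c + t * I) :=
    (continuous_airyKernel x).comp (by fun_prop)
  obtain ⟨hint, hderiv⟩ := hasDerivAt_integral_of_dominated_loc_of_deriv_le (μ := volume)
    (F := fun (c t : ℝ) => airyKernel x (c + t * I))
    (F' := fun (c t : ℝ) => (((c : ℂ) + t * I) ^ 2 - x) * airyKernel x (c + t * I))
    (bound := fun t => ((2 * c) ^ 2 + |x| + t ^ 2) *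
      (Real.exp ((2 * c) ^ 3 / 3 + |x| * (2 * c)) * Real.exp (-(c / 2) * t ^ 2)))
    (Icc_mem_nhds (a := c / 2) (b := 2 * c) (by linarith) (by linarith))
    (.of_forall fun c => ((continuous_airyKernel x).comp (by fun_prop)).aestronglyMeasurable)
    (integrable_airyKernel x hc)
    (Continuous.aestronglyMeasurable (by fun_prop))
    (.of_forall fun t c' h => norm_deriv_airyKernel_le x t (by linarith) h.1 h.2)
    (by
      simpa only [mul_left_comm] using
        (integrable_const_add_sq_mul_exp_neg_mul_sq ((2 * c) ^ 2 + |x|) (half_pos hc)).const_mul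
          (Real.exp ((2 * c) ^ 3 / 3 + |x| * (2 * c))))
    (.of_forall fun t c' _ => hline c' t)
  have hzero := integral_eq_zero_of_hasDerivAt_of_integrable hvert (hint.mul_const I)
    (integrable_airyKernel x hc)
  rw [integral_mul_const, mul_eq_zero, or_iff_left I_ne_zero] at hzero
  rwa [hzero] at hderiv

lemma airyLineIntegral_eq (x : ℝ) {c d : ℝ} (hc : 0 < c) (hd : 0 < d) :
    airyLineIntegral x c = airyLineIntegral x d :=
  isOpen_Ioi.is_const_of_deriv_eq_zero (s := Set.Ioi (0 : ℝ)) isPreconnected_Ioi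
    (fun _ h => (hasDerivAt_airyLineIntegral x h).differentiableAt.differentiableWithinAt)
    (fun _ h => (hasDerivAt_airyLineIntegral x h).deriv) hc hd

lemma conj_airyLineIntegral (x c : ℝ) :
    (starRingEnd ℂ) (airyLineIntegral x c) = airyLineIntegral x c := by
  rw [airyLineIntegral, ← integral_conj, ← integral_neg_eq_self]
  congr 1 with t
  simp [airyKernel, ← exp_conj, conj_ofNat]

lemma ofReal_Ai (x : ℝ) {c : ℝ} (hc : 0 < c) :
    (Ai x : ℂ) = (2 * Real.pi : ℂ)⁻¹ * airyLineIntegral x c := by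
  rw [airyLineIntegral_eq x hc one_pos]
  have h : (2 * (Real.pi : ℂ) * I)⁻¹ * ∫ t : ℝ, cexp ((1 + (t : ℂ) * I) ^ 3 / 3
      - (x : ℂ) * (1 + (t : ℂ) * I)) * I = (2 * Real.pi : ℂ)⁻¹ * airyLineIntegral x 1 := by
    rw [integral_mul_const, mul_inv _ I, mul_assoc, mul_comm _ I, inv_mul_cancel_left₀ I_ne_zero]
    simp [airyLineIntegral, airyKernel]
  rw [Ai, h]
  refine conj_eq_iff_re.mp ?_
  rw [map_mul, conj_airyLineIntegral]
  simp [conj_ofNat]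

lemma ofReal_Ai_eq_integral_mul (x : ℝ) {c k : ℝ} (hc : 0 < c) (hk : 0 < k) :
    (Ai x : ℂ) = (c * k / (2 * Real.pi) : ℂ) * ∫ v : ℝ, airyKernel x (c * (1 + k * v * I)) := by
  have h := Measure.integral_comp_mul_left (fun t : ℝ => airyKernel x (c + t * I)) (c * k)
  rw [abs_of_pos (by positivity), ← airyLineIntegral, real_smul] at h
  rw [ofReal_Ai x hc, show (fun v : ℝ => airyKernel x (c * (1 + k * v * I))) =
    fun v : ℝ => airyKernel x (c + (c * k * v : ℝ) * I) by ext v; push_cast; ring_nf, h]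
  have hc' : (c : ℂ) ≠ 0 := by exact_mod_cast hc.ne'
  have hk' : (k : ℂ) ≠ 0 := by exact_mod_cast hk.ne'
  push_cast
  field_simp

lemma integrable_airyKernel_mul (x : ℝ) {c k : ℝ} (hc : 0 < c) (hk : 0 < k) :
    Integrable fun v : ℝ => airyKernel x (c * (1 + k * v * I)) := by
  convert (integrable_airyKernel x hc).comp_mul_left' (mul_pos hc hk).ne' using 3 with v
  push_cast; ring

lemma exists_abs_Ai_le {c : ℝ} (hc : 0 < c) :
    ∃ C, ∀ x, |Ai x| ≤ C * Real.exp (-c * x) := by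
  refine ⟨(2 * Real.pi)⁻¹ * (Real.exp (c ^ 3 / 3) * ∫ t : ℝ, Real.exp (-c * t ^ 2)), fun x => ?_⟩
  rw [← Real.norm_eq_abs, ← norm_real, ofReal_Ai x hc, norm_mul, mul_assoc]
  have hpi : ‖(2 * Real.pi : ℂ)⁻¹‖ = (2 * Real.pi)⁻¹ := by
    simp [abs_of_pos Real.pi_pos]
  rw [hpi]
  gcongr
  refine (norm_integral_le_integral_norm _).trans_eq ?_
  simp_rw [norm_airyKernel]
  rw [integral_const_mul, sub_eq_add_neg, Real.exp_add]
  ring_nf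

lemma integrable_exp_mul_Ai {c : ℝ} (hc : 0 < c) :
    Integrable fun x : ℝ => Real.exp (c * x) * Ai x := by
  have hmeas : AEStronglyMeasurable Ai volume := by
    refine StronglyMeasurable.aestronglyMeasurable (continuous_re.comp_stronglyMeasurable ?_)
    refine (StronglyMeasurable.integral_prod_right (f := fun (x t : ℝ) =>
      cexp ((1 + (t : ℂ) * I) ^ 3 / 3 - (x : ℂ) * (1 + (t : ℂ) * I)) * I) ?_).const_mul _
    exact Continuous.stronglyMeasurable (by fun_prop)
  have hbound : ∀ d : ℝ, 0 < d → ∀ s : Set ℝ, IntegrableOn (fun x => Real.exp ((c - d) * x)) s →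
      IntegrableOn (fun x => Real.exp (c * x) * Ai x) s := fun d hd s hs => by
    obtain ⟨C, hC⟩ := exists_abs_Ai_le hd
    refine (hs.const_mul C).mono'
      ((Continuous.aestronglyMeasurable (by fun_prop)).mul hmeas.restrict) (.of_forall fun x => ?_)
    rw [norm_mul, Real.norm_eq_abs, Real.norm_eq_abs, Real.abs_exp]
    calc Real.exp (c * x) * |Ai x| ≤ Real.exp (c * x) * (C * Real.exp (-d * x)) := by
          gcongr; exact hC x
      _ = C * Real.exp ((c - d) * x) := by rw [mul_left_comm, ← Real.exp_add]; ring_nf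
  rw [← integrableOn_univ, ← Set.Iic_union_Ioi (a := (0 : ℝ))]
  exact (hbound (c / 2) (by linarith) _ (integrableOn_exp_mul_Iic (by linarith) 0)).union
    (hbound (2 * c) (by linarith) _ (integrableOn_exp_mul_Ioi (by linarith) 0))

/-- Convolution identity for the Airy function:
`∫ Ai(a+αx) Ai(b−x) dx = (1/α') Ai((a+αb)/α')` with `α' = (1+α³)^(1/3)`. -/
theorem airy_convolution (a b α : ℝ) (hα : 0 < α) :
    (∫ x : ℝ, Ai (a + α * x) * Ai (b - x)) =
      (1 / (1 + α ^ 3) ^ ((1 : ℝ) / 3)) *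
        Ai ((a + α * b) / (1 + α ^ 3) ^ ((1 : ℝ) / 3)) := by
  set f : ℝ → ℂ := fun v => airyKernel a ((1 : ℝ) * (1 + (2 * Real.pi / α : ℝ) * v * I)) with hf
  set g : ℝ → ℂ := fun v => airyKernel b (α * (1 + (2 * Real.pi / α : ℝ) * v * I)) with hg
  have hk : 0 < 2 * Real.pi / α := by positivity
  have hα' : (α : ℂ) ≠ 0 := by exact_mod_cast hα.ne'
  have hpi : (Real.pi : ℂ) ≠ 0 := by exact_mod_cast Real.pi_ne_zero
  have hfi : Integrable f := integrable_airyKernel_mul a one_pos hk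
  have hgi : Integrable g := integrable_airyKernel_mul b hα hk
  have hF : ∀ x, (Ai (a + α * x) : ℂ) = (α : ℂ)⁻¹ * (cexp (-(α * x)) * 𝓕 f x) := fun x => by
    rw [ofReal_Ai_eq_integral_mul _ one_pos hk, Real.fourier_eq', ← integral_const_mul (cexp _)]
    congr 1
    · push_cast; field_simp
    · congr 1 with v
      simp only [hf, airyKernel, smul_eq_mul, ← Complex.exp_add, RCLike.inner_apply, conj_trivial]
      congr 1
      push_cast
      field_simp
      ring
  have hG : ∀ x, (Ai (b - x) : ℂ) = cexp (α * x) * 𝓕⁻ g x := fun x => by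
    rw [ofReal_Ai_eq_integral_mul _ hα hk, Real.fourierInv_eq', ← integral_const_mul (cexp _),
      show (α * (2 * Real.pi / α : ℝ) / (2 * Real.pi) : ℂ) = 1 by push_cast; field_simp, one_mul]
    congr 1 with v
    simp only [hg, airyKernel, smul_eq_mul, ← Complex.exp_add, RCLike.inner_apply, conj_trivial]
    congr 1
    push_cast
    field_simp
    ring
  have hprod : ∀ x, ((Ai (a + α * x) * Ai (b - x) : ℝ) : ℂ) = (α : ℂ)⁻¹ * (𝓕 f x * 𝓕⁻ g x) :=
    fun x => by
      rw [ofReal_mul, hF, hG, Complex.exp_neg]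
      field_simp [Complex.exp_ne_zero]
  have hGi : Integrable (𝓕⁻ g) := by
    refine (((integrable_exp_mul_Ai hα).ofReal (𝕜 := ℂ)).comp_sub_left b
      |>.const_mul (cexp (-(α * b)))).congr (.of_forall fun x => ?_)
    simp only [coe_algebraMap, ofReal_mul, ofReal_exp, hG, ← mul_assoc, ← Complex.exp_add]
    push_cast
    ring_nf
    simp
  have hGi' : Integrable (𝓕 g) := by
    simpa [Real.fourierInv_eq_fourier_neg] using hGi.comp_neg
  have hparseval : ∫ x, 𝓕 f x * 𝓕⁻ g x = ∫ v, f v * g v := by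
    have h := VectorFourier.integral_fourierIntegral_smul_eq_flip (L := innerₗ ℝ)
      (e := Real.fourierChar) Real.continuous_fourierChar continuous_inner hfi hGi
    rw [flip_innerₗ] at h
    have hinv : 𝓕 (𝓕⁻ g) = g := Continuous.fourier_fourierInv_eq
      ((continuous_airyKernel b).comp (by fun_prop)) hgi hGi'
    conv_rhs => rw [← hinv]
    exact h
  set β : ℝ := (1 + α ^ 3) ^ ((1 : ℝ) / 3) with hβ
  have hβpos : 0 < β := by positivity
  have hβ3 : β ^ 3 = 1 + α ^ 3 := by
    rw [hβ, ← Real.rpow_natCast, ← Real.rpow_mul (by positivity)]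
    norm_num
  have hβ3' : (β : ℂ) ^ 3 = 1 + α ^ 3 := by exact_mod_cast hβ3
  have hβ' : (β : ℂ) ≠ 0 := by exact_mod_cast hβpos.ne'
  have hfg : ∀ v, f v * g v =
      airyKernel ((a + α * b) / β) (β * (1 + (2 * Real.pi / α : ℝ) * v * I)) := fun v => by
    simp only [hf, hg, airyKernel, ← Complex.exp_add, mul_pow, hβ3']
    congr 1
    push_cast
    field_simp
    ring
  rw [← ofReal_inj, ← integral_complex_ofReal, ofReal_mul, ofReal_Ai_eq_integral_mul _ hβpos hk]
  simp only [hprod]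
  rw [integral_const_mul, hparseval]
  simp only [hfg]
  generalize ∫ v : ℝ, airyKernel ((a + α * b) / β) (β * (1 + (2 * Real.pi / α : ℝ) * v * I)) = J
  push_cast
  field_simp
end

section
/- The Airy kernel shifted by ξ, defined by K_{Ai,ξ}(v₁,v₂) = ∫_0^∞ Ai(ξ+v₁+s)Ai(ξ+v₂+s) ds on L²(ℝ₊), satisfies ∂/∂ξ K_{Ai,ξ}(v₁,v₂) = −Ai(ξ+v₁)Ai(ξ+v₂). Consequently, the Fredholm determinant F₂(ξ) = det(I − K_{Ai,ξ})_{L²(ℝ₊)} satisfies F₂'(ξ) = F₂(ξ)·tr((I−K_{Ai,ξ})^{-1} Ai_ξ ⊗ Ai_ξ), where Ai_ξ(v) = Ai(ξ+v). -/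
open MeasureTheory Complex

/-- The shifted Airy kernel `K_{Ai,ξ}(v₁,v₂) = ∫₀^∞ Ai(ξ+v₁+s)Ai(ξ+v₂+s) ds`. -/
noncomputable def KAi (ξ : ℝ) (v₁ v₂ : ℝ) : ℝ :=
  ∫ s in Set.Ioi (0 : ℝ), Ai (ξ + v₁ + s) * Ai (ξ + v₂ + s)

/-- Composition of integral kernels on `L²(ℝ₊)`. -/
noncomputable def kComp (K L : ℝ → ℝ → ℝ) (v₁ v₂ : ℝ) : ℝ :=
  ∫ l in Set.Ioi (0 : ℝ), K v₁ l * L l v₂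

/-- The Fredholm determinant `det(I + K)` of an integral kernel on `L²(ℝ₊)`,
defined via the Fredholm series. -/
noncomputable def fredholmDet1 (K : ℝ → ℝ → ℝ) : ℝ :=
  ∑' n : ℕ, (1 / (Nat.factorial n) : ℝ) *
    ∫ x in {x : Fin n → ℝ | ∀ i, 0 < x i}, Matrix.det (Matrix.of fun i j => K (x i) (x j))

/-- The GUE Tracy–Widom distribution `F₂(ξ) = det(I − K_{Ai,ξ})`. -/
noncomputable def F₂ (ξ : ℝ) : ℝ := fredholmDet1 (fun v₁ v₂ => -(KAi ξ v₁ v₂))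

open Filter Topology Set

/-- The integrand of `airyInt`. -/
noncomputable def airyIntegrand (n : ℕ) (x t : ℝ) : ℂ :=
  (1 + (t : ℂ) * I) ^ n * Complex.exp ((1 + (t : ℂ) * I) ^ 3 / 3 - (x : ℂ) * (1 + (t : ℂ) * I))

/-- The moments of the contour integral defining the Airy function; up to the factor `(-1) ^ n`
and normalisation these are the derivatives of the Airy function. -/
noncomputable def airyInt (n : ℕ) (x : ℝ) : ℂ := ∫ t : ℝ, airyIntegrand n x t

/-- An integrable Gaussian majorant of `airyIntegrand n 0`. -/
noncomputable def airyMajorant (n : ℕ) (t : ℝ) : ℝ :=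
  (n.factorial : ℝ) * Real.exp 2 * Real.exp (-(1 / 2) * t ^ 2)

lemma continuous_airyIntegrand (n : ℕ) (x : ℝ) : Continuous (airyIntegrand n x) := by
  unfold airyIntegrand; fun_prop

lemma integrable_airyMajorant (n : ℕ) : Integrable (airyMajorant n) :=
  (integrable_exp_neg_mul_sq (by norm_num)).const_mul _

lemma norm_airyIntegrand_le (n : ℕ) (x t : ℝ) :
    ‖airyIntegrand n x t‖ ≤ airyMajorant n t * Real.exp (-x) := by
  have h1 : ‖(1 + (t : ℂ) * I)‖ ≤ 1 + |t| := by
    refine (norm_add_le _ _).trans ?_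
    simp
  have h2 : ((1 + (t : ℂ) * I) ^ 3 / 3 - (x : ℂ) * (1 + (t : ℂ) * I)).re = 1 / 3 - t ^ 2 - x := by
    have : (1 + (t : ℂ) * I) ^ 3 / 3 - (x : ℂ) * (1 + (t : ℂ) * I)
        = ((1 / 3 - t ^ 2 - x : ℝ) : ℂ) + ((t - t ^ 3 / 3 - x * t : ℝ) : ℂ) * I := by
      push_cast
      linear_combination ((t : ℂ) ^ 2 + (t : ℂ) ^ 3 * I / 3) * I_sq
    rw [this, add_re, ofReal_re, re_ofReal_mul, I_re, mul_zero, add_zero]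
  have h3 : (1 + |t|) ^ n ≤ n.factorial * Real.exp (1 + |t|) := by
    have := Real.pow_div_factorial_le_exp (1 + |t|) (by positivity) n
    rwa [div_le_iff₀' (by positivity)] at this
  unfold airyIntegrand airyMajorant
  rw [norm_mul, norm_pow, Complex.norm_exp, h2]
  calc ‖(1 + (t : ℂ) * I)‖ ^ n * Real.exp (1 / 3 - t ^ 2 - x)
      ≤ (n.factorial * Real.exp (1 + |t|)) * Real.exp (1 / 3 - t ^ 2 - x) := by
        gcongr
        exact (pow_le_pow_left₀ (norm_nonneg _) h1 n).trans h3
    _ = n.factorial * Real.exp (1 + |t| + (1 / 3 - t ^ 2 - x)) := by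
        rw [mul_assoc, ← Real.exp_add]
    _ ≤ n.factorial * Real.exp (2 + -(1 / 2) * t ^ 2 + -x) := by
        refine mul_le_mul_of_nonneg_left (Real.exp_le_exp.mpr ?_) (by positivity)
        nlinarith [sq_nonneg (|t| - 1), sq_abs t, abs_nonneg t]
    _ = _ := by rw [Real.exp_add, Real.exp_add]; ring

lemma integrable_airyIntegrand (n : ℕ) (x : ℝ) : Integrable (airyIntegrand n x) :=
  ((integrable_airyMajorant n).mul_const (Real.exp (-x))).mono'
    (continuous_airyIntegrand n x).aestronglyMeasurable
    (Eventually.of_forall fun t => norm_airyIntegrand_le n x t)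

lemma norm_airyInt_le (n : ℕ) (x : ℝ) :
    ‖airyInt n x‖ ≤ (∫ t, airyMajorant n t) * Real.exp (-x) := by
  rw [← integral_mul_const]
  exact norm_integral_le_of_norm_le ((integrable_airyMajorant n).mul_const _)
    (Eventually.of_forall fun t => norm_airyIntegrand_le n x t)

lemma hasDerivAt_airyInt (n : ℕ) (x : ℝ) : HasDerivAt (airyInt n) (-airyInt (n + 1) x) x := by
  have key := hasDerivAt_integral_of_dominated_loc_of_deriv_le (μ := volume)
    (F := airyIntegrand n) (F' := fun x t => -airyIntegrand (n + 1) x t) (x₀ := x)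
    (bound := fun t => airyMajorant (n + 1) t * Real.exp (-(x - 1)))
    (s := Ioi (x - 1)) (Ioi_mem_nhds (by linarith))
    (Eventually.of_forall fun y => (continuous_airyIntegrand n y).aestronglyMeasurable)
    (integrable_airyIntegrand n x)
    (continuous_airyIntegrand (n + 1) x).neg.aestronglyMeasurable
    (Eventually.of_forall fun t y hy => by
      rw [norm_neg]
      refine (norm_airyIntegrand_le (n + 1) y t).trans ?_
      have : 0 ≤ airyMajorant (n + 1) t := by unfold airyMajorant; positivity
      gcongr
      exact le_of_lt hy)
    ((integrable_airyMajorant (n + 1)).mul_const _)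
    (Eventually.of_forall fun t y _ => by
      unfold airyIntegrand
      have h : HasDerivAt (fun y : ℝ => (1 + (t : ℂ) * I) ^ 3 / 3 - (y : ℂ) * (1 + (t : ℂ) * I))
          (-(1 * (1 + (t : ℂ) * I))) y :=
        ((hasDerivAt_id y).ofReal_comp.mul_const _).const_sub _
      refine (h.cexp.const_mul ((1 + (t : ℂ) * I) ^ n)).congr_deriv ?_
      ring)
  rw [integral_neg] at key
  exact key.2

lemma airyInt_two (x : ℝ) : airyInt 2 x = x * airyInt 0 x := by
  have hd : ∀ t : ℝ, HasDerivAt (airyIntegrand 0 x)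
      (I * (airyIntegrand 2 x t - x * airyIntegrand 0 x t)) t := by
    intro t
    have h1 : HasDerivAt (fun t : ℝ => 1 + (t : ℂ) * I) (1 * I) t :=
      ((hasDerivAt_id t).ofReal_comp.mul_const I).const_add 1
    have h2 := (((h1.pow 3).div_const 3).sub (h1.const_mul (x : ℂ))).cexp
    unfold airyIntegrand
    simp only [pow_zero, one_mul] at h2 ⊢
    refine h2.congr_deriv ?_
    simp only [Pi.sub_apply, Pi.pow_apply, Nat.add_one_sub_one, Nat.cast_ofNat]
    ring
  have hint : Integrable fun t => I * (airyIntegrand 2 x t - x * airyIntegrand 0 x t) :=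
    ((integrable_airyIntegrand 2 x).sub ((integrable_airyIntegrand 0 x).const_mul _)).const_mul _
  have h0 := integral_eq_zero_of_hasDerivAt_of_integrable hd hint (integrable_airyIntegrand 0 x)
  rw [integral_const_mul, integral_sub (integrable_airyIntegrand 2 x)
    ((integrable_airyIntegrand 0 x).const_mul _), integral_const_mul] at h0
  have := (mul_eq_zero.mp h0).resolve_left I_ne_zero
  exact sub_eq_zero.mp this

/-- The derivative of the Airy function. -/
noncomputable def AiDeriv (x : ℝ) : ℝ := -(2 * Real.pi)⁻¹ * (airyInt 1 x).re

lemma Ai_eq (x : ℝ) : Ai x = (2 * Real.pi)⁻¹ * (airyInt 0 x).re := by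
  have h : (∫ t : ℝ, Complex.exp ((1 + (t : ℂ) * Complex.I) ^ 3 / 3
      - (x : ℂ) * (1 + (t : ℂ) * Complex.I)) * Complex.I) = airyInt 0 x * I := by
    unfold airyInt airyIntegrand
    rw [← integral_mul_const]
    simp
  unfold Ai
  rw [h]
  have : (2 * (Real.pi : ℂ) * I)⁻¹ * (airyInt 0 x * I) = ((2 * Real.pi)⁻¹ : ℝ) * airyInt 0 x := by
    have : (Real.pi : ℂ) ≠ 0 := by exact_mod_cast Real.pi_ne_zero
    have := I_ne_zero
    push_cast
    field_simp
  rw [this, re_ofReal_mul]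

lemma hasDerivAt_re {f : ℝ → ℂ} {f' : ℂ} {x : ℝ} (h : HasDerivAt f f' x) :
    HasDerivAt (fun y => (f y).re) f'.re x :=
  reCLM.hasFDerivAt.comp_hasDerivAt x h

lemma hasDerivAt_Ai (x : ℝ) : HasDerivAt Ai (AiDeriv x) x := by
  have : Ai = fun y => (2 * Real.pi)⁻¹ * (airyInt 0 y).re := funext Ai_eq
  rw [this]
  refine ((hasDerivAt_re (hasDerivAt_airyInt 0 x)).const_mul _).congr_deriv ?_
  simp [AiDeriv]

lemma hasDerivAt_AiDeriv (x : ℝ) : HasDerivAt AiDeriv (x * Ai x) x := by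
  refine ((hasDerivAt_re (hasDerivAt_airyInt 1 x)).const_mul (-(2 * Real.pi)⁻¹)).congr_deriv ?_
  rw [airyInt_two, Ai_eq]
  simp
  ring

lemma exists_Ai_bound : ∃ C : ℝ, 0 < C ∧ ∀ x, |Ai x| ≤ C * Real.exp (-x) ∧
    |AiDeriv x| ≤ C * Real.exp (-x) := by
  refine ⟨(2 * Real.pi)⁻¹ * (∫ t, airyMajorant 0 t) + (2 * Real.pi)⁻¹ * (∫ t, airyMajorant 1 t) + 1,
    ?_, fun x => ?_⟩
  · have h : ∀ n, 0 ≤ ∫ t, airyMajorant n t := fun n =>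
      integral_nonneg fun t => by unfold airyMajorant; positivity
    have := h 0
    have := h 1
    positivity
  · have h : ∀ n, 0 ≤ ∫ t, airyMajorant n t := fun n =>
      integral_nonneg fun t => by unfold airyMajorant; positivity
    have hb : ∀ n, |(2 * Real.pi)⁻¹ * (airyInt n x).re|
        ≤ (2 * Real.pi)⁻¹ * (∫ t, airyMajorant n t) * Real.exp (-x) := fun n => by
      rw [abs_mul, abs_of_nonneg (by positivity : 0 ≤ (2 * Real.pi)⁻¹), mul_assoc]
      gcongr
      exact (abs_re_le_norm _).trans (norm_airyInt_le n x)
    have e := Real.exp_pos (-x)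
    have p : 0 < (2 * Real.pi)⁻¹ := by positivity
    have h0 := mul_nonneg (mul_nonneg p.le (h 0)) e.le
    have h1 := mul_nonneg (mul_nonneg p.le (h 1)) e.le
    constructor
    · rw [Ai_eq]
      refine (hb 0).trans ?_
      linarith
    · rw [AiDeriv, neg_mul, abs_neg]
      refine (hb 1).trans ?_
      linarith

lemma continuous_Ai : Continuous Ai :=
  continuous_iff_continuousAt.mpr fun x => (hasDerivAt_Ai x).continuousAt

lemma integrableOn_Ai_mul_Ai (a b c : ℝ) :
    IntegrableOn (fun s => Ai (a + s) * Ai (b + s)) (Ioi c) := by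
  obtain ⟨C, hC, hA⟩ := exists_Ai_bound
  have hcont : Continuous fun s => Ai (a + s) * Ai (b + s) := by
    have := continuous_Ai; fun_prop
  refine Integrable.mono' ((integrableOn_exp_mul_Ioi (a := -2) (by norm_num) c).const_mul
    (C ^ 2 * Real.exp (-a - b))) hcont.aestronglyMeasurable (Eventually.of_forall fun s => ?_)
  rw [Real.norm_eq_abs, abs_mul]
  calc |Ai (a + s)| * |Ai (b + s)|
      ≤ (C * Real.exp (-(a + s))) * (C * Real.exp (-(b + s))) := by
        gcongr
        exacts [(hA _).1, (hA _).1]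
    _ = C ^ 2 * (Real.exp (-(a + s)) * Real.exp (-(b + s))) := by ring
    _ = C ^ 2 * Real.exp (-a - b) * Real.exp (-2 * s) := by
        rw [mul_assoc, ← Real.exp_add, ← Real.exp_add]; ring_nf

/-- The Airy kernel. -/
noncomputable def airyKer (a b : ℝ) : ℝ := ∫ s in Ioi (0 : ℝ), Ai (a + s) * Ai (b + s)

lemma KAi_eq (ξ v₁ v₂ : ℝ) : KAi ξ v₁ v₂ = airyKer (ξ + v₁) (ξ + v₂) := rfl

lemma airyKer_symm (a b : ℝ) : airyKer a b = airyKer b a := by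
  unfold airyKer; simp_rw [mul_comm]

lemma exists_airyKer_bound : ∃ C : ℝ, 0 < C ∧ ∀ a b, |airyKer a b| ≤ C * Real.exp (-a - b) := by
  obtain ⟨C, hC, hA⟩ := exists_Ai_bound
  refine ⟨C ^ 2, by positivity, fun a b => ?_⟩
  have hint : IntegrableOn (fun s : ℝ => C ^ 2 * Real.exp (-a - b) * Real.exp (-s)) (Ioi 0) :=
    (integrableOn_exp_neg_Ioi 0).const_mul _
  have hle : ∀ᵐ s ∂volume.restrict (Ioi (0 : ℝ)),
      ‖Ai (a + s) * Ai (b + s)‖ ≤ C ^ 2 * Real.exp (-a - b) * Real.exp (-s) := by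
    filter_upwards [ae_restrict_mem measurableSet_Ioi] with s hs
    rw [Real.norm_eq_abs, abs_mul]
    calc |Ai (a + s)| * |Ai (b + s)|
        ≤ (C * Real.exp (-(a + s))) * (C * Real.exp (-(b + s))) := by
          gcongr
          exacts [(hA _).1, (hA _).1]
      _ = C ^ 2 * (Real.exp (-(a + s)) * Real.exp (-(b + s))) := by ring
      _ = C ^ 2 * Real.exp (-a - b + -(2 * s)) := by
          rw [← Real.exp_add]; ring_nf
      _ ≤ C ^ 2 * Real.exp (-a - b + -s) := by
          have : 0 < s := hs
          gcongr
          linarith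
      _ = _ := by rw [Real.exp_add]; ring
  have := norm_integral_le_of_norm_le hint hle
  rwa [integral_const_mul, integral_exp_neg_Ioi_zero, mul_one] at this

lemma continuous_airyKer : Continuous fun p : ℝ × ℝ => airyKer p.1 p.2 := by
  obtain ⟨C, hC, hA⟩ := exists_Ai_bound
  refine continuous_iff_continuousAt.mpr fun p => ?_
  refine continuousAt_of_dominated
    (bound := fun s => C ^ 2 * Real.exp (2 - p.1 - p.2) * Real.exp (-2 * s))
    (Eventually.of_forall fun q => ?_) ?_
    ((integrableOn_exp_mul_Ioi (a := -2) (by norm_num) 0).const_mul _)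
    (Eventually.of_forall fun s => ?_)
  · have := continuous_Ai
    exact Continuous.aestronglyMeasurable (by fun_prop)
  · have h1 : ∀ᶠ q : ℝ × ℝ in 𝓝 p, p.1 - 1 < q.1 :=
      continuous_fst.continuousAt.eventually (lt_mem_nhds (by linarith))
    have h2 : ∀ᶠ q : ℝ × ℝ in 𝓝 p, p.2 - 1 < q.2 :=
      continuous_snd.continuousAt.eventually (lt_mem_nhds (by linarith))
    filter_upwards [h1, h2] with q h1 h2
    refine Eventually.of_forall fun s => ?_
    rw [Real.norm_eq_abs, abs_mul]
    calc |Ai (q.1 + s)| * |Ai (q.2 + s)|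
        ≤ (C * Real.exp (-(q.1 + s))) * (C * Real.exp (-(q.2 + s))) := by
          gcongr
          exacts [(hA _).1, (hA _).1]
      _ ≤ (C * Real.exp (-(p.1 - 1 + s))) * (C * Real.exp (-(p.2 - 1 + s))) := by
          gcongr
      _ = C ^ 2 * (Real.exp (-(p.1 - 1 + s)) * Real.exp (-(p.2 - 1 + s))) := by ring
      _ = _ := by
          rw [mul_assoc, ← Real.exp_add, ← Real.exp_add]; ring_nf
  · have := continuous_Ai
    exact Continuous.continuousAt (by fun_prop)

lemma hasDerivAt_integral_Ioi_shift {f : ℝ → ℝ} (hf : Continuous f)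
    (hint : ∀ c, IntegrableOn f (Ioi c)) (x : ℝ) :
    HasDerivAt (fun x => ∫ s in Ioi (0 : ℝ), f (x + s)) (-f x) x := by
  have h : ∀ x, ∫ s in Ioi (0 : ℝ), f (x + s) = (∫ s in Ioi (0 : ℝ), f s) - ∫ s in (0 : ℝ)..x, f s := by
    intro x
    have h1 := (measurePreserving_add_left volume x).setIntegral_preimage_emb
      (measurableEmbedding_addLeft x) f (Ioi x)
    have h2 : (x + ·) ⁻¹' Ioi x = Ioi (0 : ℝ) := by ext s; simp
    rw [h2] at h1
    rw [h1, ← intervalIntegral.integral_interval_add_Ioi (hint 0) (hint x)]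
    ring
  rw [funext h]
  exact (intervalIntegral.integral_hasDerivAt_right (hf.intervalIntegrable _ _)
    (hf.stronglyMeasurableAtFilter _ _) hf.continuousAt).const_sub _

lemma hasDerivAt_KAi (ξ v₁ v₂ : ℝ) :
    HasDerivAt (fun x => KAi x v₁ v₂) (-(Ai (ξ + v₁) * Ai (ξ + v₂))) ξ := by
  have hcont : Continuous fun s => Ai (v₁ + s) * Ai (v₂ + s) := by
    have := continuous_Ai; fun_prop
  have h := hasDerivAt_integral_Ioi_shift hcont (integrableOn_Ai_mul_Ai v₁ v₂) ξ
  unfold KAi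
  simpa only [add_comm, add_left_comm, add_assoc] using h

lemma airyKer_christoffelDarboux (a b : ℝ) :
    (a - b) * airyKer a b = Ai a * AiDeriv b - AiDeriv a * Ai b := by
  obtain ⟨C, hC, hA⟩ := exists_Ai_bound
  have hsh : ∀ c s : ℝ, HasDerivAt (fun s => c + s) 1 s := fun c s => (hasDerivAt_id s).const_add c
  have hd : ∀ s : ℝ, HasDerivAt
      (fun s => Ai (a + s) * AiDeriv (b + s) - AiDeriv (a + s) * Ai (b + s))
      ((b - a) * (Ai (a + s) * Ai (b + s))) s := by
    intro s
    have h1 := (hasDerivAt_Ai (a + s)).comp s (hsh a s)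
    have h2 := (hasDerivAt_Ai (b + s)).comp s (hsh b s)
    have h3 := (hasDerivAt_AiDeriv (a + s)).comp s (hsh a s)
    have h4 := (hasDerivAt_AiDeriv (b + s)).comp s (hsh b s)
    refine ((h1.mul h4).sub (h3.mul h2)).congr_deriv ?_
    simp only [Function.comp]
    ring
  have hA0 : ∀ c, Tendsto (fun s => Ai (c + s)) atTop (𝓝 0) ∧
      Tendsto (fun s => AiDeriv (c + s)) atTop (𝓝 0) := by
    intro c
    have he : Tendsto (fun s => C * Real.exp (-(c + s))) atTop (𝓝 0) := by
      have := (Real.tendsto_exp_neg_atTop_nhds_zero.comp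
        (tendsto_atTop_add_const_left atTop c tendsto_id)).const_mul C
      simpa using this
    exact ⟨squeeze_zero_norm (fun s => (hA _).1) he, squeeze_zero_norm (fun s => (hA _).2) he⟩
  have hlim : Tendsto (fun s => Ai (a + s) * AiDeriv (b + s) - AiDeriv (a + s) * Ai (b + s))
      atTop (𝓝 0) := by
    simpa using ((hA0 a).1.mul (hA0 b).2).sub ((hA0 a).2.mul (hA0 b).1)
  have h := integral_Ioi_of_hasDerivAt_of_tendsto' (a := 0) (fun s _ => hd s)
    ((integrableOn_Ai_mul_Ai a b 0).const_mul _) hlim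
  rw [integral_const_mul] at h
  simp only [add_zero] at h
  unfold airyKer
  linarith

/-- The Cauchy data of the Airy equation, as a sum of squares. -/
noncomputable def airyEnergy (x : ℝ) : ℝ := Ai x ^ 2 + AiDeriv x ^ 2

lemma airyEnergy_nonneg (x : ℝ) : 0 ≤ airyEnergy x := by unfold airyEnergy; positivity

lemma hasDerivAt_airyEnergy (x : ℝ) :
    HasDerivAt airyEnergy (2 * (1 + x) * (Ai x * AiDeriv x)) x := by
  refine (((hasDerivAt_Ai x).pow 2).add ((hasDerivAt_AiDeriv x).pow 2)).congr_deriv ?_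
  norm_num
  ring

lemma two_mul_abs_Ai_mul_AiDeriv_le (x : ℝ) :
    |2 * (1 + x) * (Ai x * AiDeriv x)| ≤ (2 + x ^ 2) * airyEnergy x := by
  have h1 : |1 + x| ≤ 2 + x ^ 2 := by rw [abs_le]; constructor <;> nlinarith [sq_nonneg (x - 1), sq_nonneg (x + 1)]
  have h2 : |2 * (Ai x * AiDeriv x)| ≤ airyEnergy x := by
    unfold airyEnergy
    rw [abs_le]; constructor <;> nlinarith [sq_nonneg (Ai x - AiDeriv x), sq_nonneg (Ai x + AiDeriv x)]
  calc |2 * (1 + x) * (Ai x * AiDeriv x)| = |1 + x| * |2 * (Ai x * AiDeriv x)| := by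
        rw [← abs_mul]; ring_nf
    _ ≤ _ := by gcongr

lemma hasDerivAt_airyEnergy_mul_exp (σ x : ℝ) :
    HasDerivAt (fun x => airyEnergy x * Real.exp (σ * (2 * x + x ^ 3 / 3)))
      ((2 * (1 + x) * (Ai x * AiDeriv x) + σ * (2 + x ^ 2) * airyEnergy x)
        * Real.exp (σ * (2 * x + x ^ 3 / 3))) x := by
  have hp : HasDerivAt (fun x : ℝ => σ * (2 * x + x ^ 3 / 3)) (σ * (2 + x ^ 2)) x := by
    refine ((((hasDerivAt_id x).const_mul 2).add
      (((hasDerivAt_id x).pow 3).div_const 3)).const_mul σ).congr_deriv ?_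
    simp
  refine ((hasDerivAt_airyEnergy x).mul hp.exp).congr_deriv ?_
  ring

lemma monotone_airyEnergy_mul_exp :
    Monotone fun x => airyEnergy x * Real.exp (1 * (2 * x + x ^ 3 / 3)) := by
  refine monotone_of_deriv_nonneg
    (fun x => (hasDerivAt_airyEnergy_mul_exp 1 x).differentiableAt) fun x => ?_
  rw [(hasDerivAt_airyEnergy_mul_exp 1 x).deriv]
  have := neg_le_of_abs_le (two_mul_abs_Ai_mul_AiDeriv_le x)
  exact mul_nonneg (by linarith) (Real.exp_pos _).le

lemma antitone_airyEnergy_mul_exp :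
    Antitone fun x => airyEnergy x * Real.exp ((-1) * (2 * x + x ^ 3 / 3)) := by
  refine antitone_of_deriv_nonpos
    (fun x => (hasDerivAt_airyEnergy_mul_exp (-1) x).differentiableAt) fun x => ?_
  rw [(hasDerivAt_airyEnergy_mul_exp (-1) x).deriv]
  have := le_of_abs_le (two_mul_abs_Ai_mul_AiDeriv_le x)
  exact mul_nonpos_of_nonpos_of_nonneg (by linarith) (Real.exp_pos _).le

lemma Ai_eq_zero_of_airyEnergy_eq_zero {b : ℝ} (hb : airyEnergy b = 0) (x : ℝ) : Ai x = 0 := by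
  have hx : airyEnergy x ≤ 0 := by
    rcases le_total x b with h | h
    · have := monotone_airyEnergy_mul_exp h
      simp only [hb, zero_mul] at this
      exact nonpos_of_mul_nonpos_left this (Real.exp_pos _)
    · have := antitone_airyEnergy_mul_exp h
      simp only [hb, zero_mul] at this
      exact nonpos_of_mul_nonpos_left this (Real.exp_pos _)
  unfold airyEnergy at hx
  have : Ai x ^ 2 = 0 := le_antisymm (by nlinarith [sq_nonneg (AiDeriv x)]) (sq_nonneg _)
  exact pow_eq_zero_iff (two_ne_zero) |>.mp this

lemma Ai_mul_AiDeriv_nonpos {x : ℝ} (hx : 0 ≤ x) : Ai x * AiDeriv x ≤ 0 := by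
  obtain ⟨C, hC, hA⟩ := exists_Ai_bound
  have hd : ∀ y, HasDerivAt (fun y => Ai y * AiDeriv y) (AiDeriv y ^ 2 + y * Ai y ^ 2) y := fun y =>
    ((hasDerivAt_Ai y).mul (hasDerivAt_AiDeriv y)).congr_deriv (by ring)
  have hmono : MonotoneOn (fun y => Ai y * AiDeriv y) (Ici 0) := by
    refine monotoneOn_of_deriv_nonneg (convex_Ici 0)
      (fun y _ => (hd y).continuousAt.continuousWithinAt)
      (fun y _ => (hd y).differentiableAt.differentiableWithinAt) fun y hy => ?_
    rw [interior_Ici] at hy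
    have : (0 : ℝ) < y := hy
    rw [(hd y).deriv]
    positivity
  have hlim : Tendsto (fun y => Ai y * AiDeriv y) atTop (𝓝 0) := by
    have he : Tendsto (fun s => C * Real.exp (-s)) atTop (𝓝 0) := by
      simpa using Real.tendsto_exp_neg_atTop_nhds_zero.const_mul C
    have h1 : Tendsto Ai atTop (𝓝 0) := squeeze_zero_norm (fun s => (hA s).1) he
    have h2 : Tendsto AiDeriv atTop (𝓝 0) := squeeze_zero_norm (fun s => (hA s).2) he
    simpa using h1.mul h2
  refine ge_of_tendsto hlim ?_
  filter_upwards [eventually_ge_atTop x] with y hy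
  exact hmono hx (hx.trans hy) hy

lemma antitoneOn_airyEnergy : AntitoneOn airyEnergy (Ici 0) := by
  refine antitoneOn_of_deriv_nonpos (convex_Ici 0)
    (fun y _ => (hasDerivAt_airyEnergy y).continuousAt.continuousWithinAt)
    (fun y _ => (hasDerivAt_airyEnergy y).differentiableAt.differentiableWithinAt) fun y hy => ?_
  rw [interior_Ici] at hy
  have hy : (0 : ℝ) < y := hy
  rw [(hasDerivAt_airyEnergy y).deriv]
  exact mul_nonpos_of_nonneg_of_nonpos (by linarith) (Ai_mul_AiDeriv_nonpos hy.le)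

lemma exists_airyEnergy_le (ξ : ℝ) :
    ∃ C : ℝ, 1 ≤ C ∧ ∀ b c, ξ ≤ b → b ≤ c → airyEnergy c ≤ C * airyEnergy b := by
  have hloc : ∀ b c, b ≤ c → airyEnergy c ≤
      Real.exp ((2 * c + c ^ 3 / 3) - (2 * b + b ^ 3 / 3)) * airyEnergy b := by
    intro b c hbc
    have := antitone_airyEnergy_mul_exp hbc
    simp only [neg_mul, one_mul] at this
    rw [sub_eq_add_neg, Real.exp_add, mul_assoc, mul_comm (Real.exp (-_))]
    calc airyEnergy c = Real.exp (2 * c + c ^ 3 / 3) *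
          (airyEnergy c * Real.exp (-(2 * c + c ^ 3 / 3))) := by
          rw [mul_left_comm, ← Real.exp_add]; simp
      _ ≤ _ := by gcongr
  have hmono : ∀ b, ξ ≤ b → -(2 * b + b ^ 3 / 3) ≤ |2 * ξ + ξ ^ 3 / 3| := by
    intro b hb
    have : 2 * ξ + ξ ^ 3 / 3 ≤ 2 * b + b ^ 3 / 3 := by
      nlinarith [sq_nonneg (b + ξ), sq_nonneg b, sq_nonneg ξ, mul_nonneg (sub_nonneg.mpr hb) (sq_nonneg (b + ξ)), mul_nonneg (sub_nonneg.mpr hb) (sq_nonneg b), mul_nonneg (sub_nonneg.mpr hb) (sq_nonneg ξ)]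
    exact (by linarith : _ ≤ -(2 * ξ + ξ ^ 3 / 3)).trans (neg_le_abs _)
  refine ⟨Real.exp |2 * ξ + ξ ^ 3 / 3|, Real.one_le_exp (abs_nonneg _), fun b c hb hbc => ?_⟩
  have hup : ∀ c', b ≤ c' → c' ≤ 0 →
      airyEnergy c' ≤ Real.exp |2 * ξ + ξ ^ 3 / 3| * airyEnergy b := by
    intro c' h1 h2
    refine (hloc b c' h1).trans ?_
    have := airyEnergy_nonneg b
    have h3 := hmono b hb
    have : c' ^ 3 ≤ 0 := by nlinarith [sq_nonneg c']
    gcongr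
    linarith
  rcases le_total 0 b with h0 | h0
  · calc airyEnergy c ≤ airyEnergy b := antitoneOn_airyEnergy h0 (h0.trans hbc) hbc
      _ ≤ _ := le_mul_of_one_le_left (airyEnergy_nonneg b) (Real.one_le_exp (abs_nonneg _))
  · rcases le_total c 0 with h1 | h1
    · exact hup c hbc h1
    · exact (antitoneOn_airyEnergy (mem_Ici.mpr le_rfl) h1 h1).trans (hup 0 h0 le_rfl)

lemma exists_Ai_add_le (ξ : ℝ) :
    ∃ C : ℝ, 0 < C ∧ ∀ b s, ξ ≤ b → 0 ≤ s → |Ai (b + s)| ≤ C * (|Ai b| + |AiDeriv b|) := by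
  obtain ⟨C, hC, h⟩ := exists_airyEnergy_le ξ
  refine ⟨C, by linarith, fun b s hb hs => ?_⟩
  have h1 := h b (b + s) hb (by linarith)
  refine abs_le_of_sq_le_sq ?_ (by positivity)
  have h2 : Ai (b + s) ^ 2 ≤ airyEnergy (b + s) := by
    unfold airyEnergy; nlinarith [sq_nonneg (AiDeriv (b + s))]
  have h3 : airyEnergy b ≤ (|Ai b| + |AiDeriv b|) ^ 2 := by
    unfold airyEnergy
    nlinarith [sq_abs (Ai b), sq_abs (AiDeriv b), mul_nonneg (abs_nonneg (Ai b)) (abs_nonneg (AiDeriv b))]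
  calc Ai (b + s) ^ 2 ≤ C * airyEnergy b := h2.trans h1
    _ ≤ C ^ 2 * (|Ai b| + |AiDeriv b|) ^ 2 := by
        exact mul_le_mul (by nlinarith) h3 (airyEnergy_nonneg b) (by positivity)
    _ = _ := by ring

lemma exists_airyKer_le_mul (ξ : ℝ) :
    ∃ C : ℝ, 0 < C ∧ ∀ a b, ξ ≤ b →
      |airyKer a b| ≤ C * Real.exp (-a) * (|Ai b| + |AiDeriv b|) := by
  obtain ⟨C, hC, hA⟩ := exists_Ai_bound
  obtain ⟨D, hD, hb⟩ := exists_Ai_add_le ξ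
  refine ⟨C * D, by positivity, fun a b hξ => ?_⟩
  have hint : IntegrableOn (fun s : ℝ => C * D * Real.exp (-a) * (|Ai b| + |AiDeriv b|) *
      Real.exp (-s)) (Ioi 0) := (integrableOn_exp_neg_Ioi 0).const_mul _
  have hle : ∀ᵐ s ∂volume.restrict (Ioi (0 : ℝ)), ‖Ai (a + s) * Ai (b + s)‖ ≤
      C * D * Real.exp (-a) * (|Ai b| + |AiDeriv b|) * Real.exp (-s) := by
    filter_upwards [ae_restrict_mem measurableSet_Ioi] with s hs
    rw [Real.norm_eq_abs, abs_mul]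
    calc |Ai (a + s)| * |Ai (b + s)|
        ≤ (C * Real.exp (-(a + s))) * (D * (|Ai b| + |AiDeriv b|)) := by
          gcongr
          exacts [(hA _).1, hb b s hξ (le_of_lt hs)]
      _ = _ := by rw [neg_add, Real.exp_add]; ring
  have := norm_integral_le_of_norm_le hint hle
  rwa [integral_const_mul, integral_exp_neg_Ioi_zero, mul_one] at this

lemma airyKer_self_pos (hAi : ∃ x, Ai x ≠ 0) (a : ℝ) : 0 < airyKer a a := by
  have hcont : Continuous fun s => Ai (a + s) * Ai (a + s) := by
    have := continuous_Ai; fun_prop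
  unfold airyKer
  rw [setIntegral_pos_iff_support_of_nonneg_ae (Eventually.of_forall fun s => mul_self_nonneg _)
    (integrableOn_Ai_mul_Ai a a 0)]
  refine (hcont.isOpen_support.inter isOpen_Ioi).measure_pos volume ?_
  by_contra hne
  rw [Set.not_nonempty_iff_eq_empty] at hne
  have hz : ∀ s, 0 < s → Ai (a + s) = 0 := by
    intro s hs
    by_contra h0
    have : s ∈ (Function.support fun s => Ai (a + s) * Ai (a + s)) ∩ Ioi 0 :=
      ⟨mul_ne_zero h0 h0, hs⟩
    rw [hne] at this
    exact this
  have hz' : ∀ᶠ y in 𝓝 (a + 1), Ai y = 0 := by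
    filter_upwards [lt_mem_nhds (show a < a + 1 by linarith)] with y hy
    have := hz (y - a) (by linarith)
    rwa [add_sub_cancel] at this
  have h1 : AiDeriv (a + 1) = 0 :=
    ((hasDerivAt_Ai (a + 1)).congr_of_eventuallyEq (f₁ := fun _ => (0 : ℝ))
      (hz'.mono fun y hy => hy.symm)).unique (hasDerivAt_const _ _)
  obtain ⟨x, hx⟩ := hAi
  refine hx (Ai_eq_zero_of_airyEnergy_eq_zero (b := a + 1) ?_ x)
  rw [airyEnergy, h1, hz 1 one_pos]
  norm_num

lemma exists_airyData_le (ξ : ℝ) {p q : ℝ} (hpq : p ≠ q) (hK : airyKer (ξ + p) (ξ + q) ≠ 0) :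
    ∃ C : ℝ, 0 < C ∧ ∀ l, 0 < l → |Ai (ξ + l)| + |AiDeriv (ξ + l)| ≤
      C * ((1 + l) * (|airyKer (ξ + p) (ξ + l)| + |airyKer (ξ + q) (ξ + l)|)) := by
  set D := Ai (ξ + p) * AiDeriv (ξ + q) - AiDeriv (ξ + p) * Ai (ξ + q) with hDdef
  have hD : D ≠ 0 := by
    rw [hDdef, ← airyKer_christoffelDarboux]
    exact mul_ne_zero (by intro h; apply hpq; linarith) hK
  set s := |Ai (ξ + p)| + |Ai (ξ + q)| + |AiDeriv (ξ + p)| + |AiDeriv (ξ + q)| with hs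
  set T := |p| + |q| + 1 with hT
  have hDpos : 0 < |D| := abs_pos.mpr hD
  refine ⟨2 * s * T / |D| + 1, by positivity, fun l hl => ?_⟩
  set M := |airyKer (ξ + p) (ξ + l)| + |airyKer (ξ + q) (ξ + l)| with hM
  have hP := airyKer_christoffelDarboux (ξ + p) (ξ + l)
  have hQ := airyKer_christoffelDarboux (ξ + q) (ξ + l)
  set P := ((ξ + p) - (ξ + l)) * airyKer (ξ + p) (ξ + l) with hPdef
  set Q := ((ξ + q) - (ξ + l)) * airyKer (ξ + q) (ξ + l) with hQdef
  have hM0 : 0 ≤ M := by positivity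
  have hT1 : 1 ≤ T := by have := abs_nonneg p; have := abs_nonneg q; linarith
  have hdist : ∀ c, |c| ≤ T - 1 → |(ξ + c) - (ξ + l)| ≤ T * (1 + l) := by
    intro c hc
    have h1 : |(ξ + c) - (ξ + l)| ≤ |c| + |l| := by
      rw [show (ξ + c) - (ξ + l) = c - l by ring]; exact abs_sub c l
    rw [abs_of_pos hl] at h1
    nlinarith
  have hPle : |P| + |Q| ≤ T * (1 + l) * M := by
    rw [hPdef, hQdef, abs_mul, abs_mul, hM, mul_add]
    gcongr
    · exact hdist p (by rw [hT]; have := abs_nonneg q; linarith)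
    · exact hdist q (by rw [hT]; have := abs_nonneg p; linarith)
  have hcomb : ∀ a b z, |a| ≤ s → |b| ≤ s → D * z = a * P - b * Q →
      |z| ≤ s * T / |D| * ((1 + l) * M) := by
    intro a b z ha hb hz
    have h1 : |D| * |z| ≤ s * (T * (1 + l) * M) := by
      rw [← abs_mul, hz]
      calc |a * P - b * Q| ≤ |a| * |P| + |b| * |Q| := by
            rw [← abs_mul, ← abs_mul]; exact abs_sub _ _
        _ ≤ s * |P| + s * |Q| := by gcongr
        _ = s * (|P| + |Q|) := by ring
        _ ≤ _ := by gcongr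
    rw [show s * T / |D| * ((1 + l) * M) = s * (T * (1 + l) * M) / |D| by ring,
      le_div_iff₀ hDpos, mul_comm]
    exact h1
  have n1 := abs_nonneg (Ai (ξ + p))
  have n2 := abs_nonneg (Ai (ξ + q))
  have n3 := abs_nonneg (AiDeriv (ξ + p))
  have n4 := abs_nonneg (AiDeriv (ξ + q))
  have hA := hcomb (Ai (ξ + q)) (Ai (ξ + p)) (Ai (ξ + l)) (by linarith) (by linarith)
    (by rw [hP, hQ]; ring)
  have hB := hcomb (AiDeriv (ξ + q)) (AiDeriv (ξ + p)) (AiDeriv (ξ + l)) (by linarith) (by linarith)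
    (by rw [hP, hQ]; ring)
  have : 0 ≤ (1 + l) * M := by positivity
  calc _ ≤ 2 * s * T / |D| * ((1 + l) * M) := by
        rw [show 2 * s * T / |D| * ((1 + l) * M) = s * T / |D| * ((1 + l) * M) +
          s * T / |D| * ((1 + l) * M) by ring]
        exact add_le_add hA hB
    _ ≤ _ := by gcongr; linarith

lemma exists_airyKer_le_sections (ξ : ℝ) {p q : ℝ} (hpq : p ≠ q)
    (hK : airyKer (ξ + p) (ξ + q) ≠ 0) :
    ∃ C : ℝ, 0 < C ∧ ∀ w l, 0 < w → 0 < l → |airyKer (ξ + w) (ξ + l)| ≤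
      C * Real.exp (-w / 2) * (|airyKer (ξ + p) (ξ + l)| + |airyKer (ξ + q) (ξ + l)|) := by
  obtain ⟨C₀, hC₀, hdata⟩ := exists_airyData_le ξ hpq hK
  obtain ⟨C₁, hC₁, hA⟩ := exists_Ai_bound
  obtain ⟨C₂, hC₂, hker⟩ := exists_airyKer_le_mul ξ
  set E := (2 * C₁ + C₂) * Real.exp (-ξ) * C₀ with hE
  have hmain : ∀ w l, 0 < w → 0 < l → |airyKer (ξ + w) (ξ + l)| ≤
      E * ((2 + w) * Real.exp (-w)) *
        (|airyKer (ξ + p) (ξ + l)| + |airyKer (ξ + q) (ξ + l)|) := by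
    intro w l hw hl
    have hd := hdata l hl
    set M := |airyKer (ξ + p) (ξ + l)| + |airyKer (ξ + q) (ξ + l)| with hM
    set N := |Ai (ξ + l)| + |AiDeriv (ξ + l)| with hN
    have hexp : Real.exp (-(ξ + w)) = Real.exp (-ξ) * Real.exp (-w) := by
      rw [neg_add, Real.exp_add]
    rcases lt_or_ge |w - l| 1 with h1 | h1
    · have h2 := hker (ξ + w) (ξ + l) (by linarith)
      have h3 : 1 + l ≤ 2 + w := by have := (abs_lt.mp h1).1; linarith
      calc |airyKer (ξ + w) (ξ + l)| ≤ C₂ * Real.exp (-(ξ + w)) * N := h2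
        _ ≤ C₂ * Real.exp (-(ξ + w)) * (C₀ * ((2 + w) * M)) := by
            gcongr
            exact hd.trans (by gcongr)
        _ = C₂ * Real.exp (-ξ) * C₀ * ((2 + w) * Real.exp (-w)) * M := by rw [hexp]; ring
        _ ≤ E * ((2 + w) * Real.exp (-w)) * M := by
            rw [hE]; gcongr; linarith
    · have hcd := airyKer_christoffelDarboux (ξ + w) (ξ + l)
      rw [show ξ + w - (ξ + l) = w - l by ring] at hcd
      have h2 : |w - l| * |airyKer (ξ + w) (ξ + l)| ≤ 2 * C₁ * Real.exp (-(ξ + w)) * N := by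
        rw [← abs_mul, hcd]
        calc _ ≤ |Ai (ξ + w)| * |AiDeriv (ξ + l)| + |AiDeriv (ξ + w)| * |Ai (ξ + l)| := by
              rw [← abs_mul, ← abs_mul]; exact abs_sub _ _
          _ ≤ (C₁ * Real.exp (-(ξ + w))) * N + (C₁ * Real.exp (-(ξ + w))) * N := by
              gcongr
              · exact (hA _).1
              · rw [hN]; linarith [abs_nonneg (Ai (ξ + l))]
              · exact (hA _).2
              · rw [hN]; linarith [abs_nonneg (AiDeriv (ξ + l))]
          _ = _ := by ring
      have h3 : 1 + l ≤ (2 + w) * |w - l| := by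
        have : l ≤ w + |w - l| := by have := neg_abs_le (w - l); linarith
        nlinarith
      have h4 : |w - l| * |airyKer (ξ + w) (ξ + l)| ≤
          |w - l| * (E * ((2 + w) * Real.exp (-w)) * M) := by
        calc _ ≤ 2 * C₁ * Real.exp (-(ξ + w)) * N := h2
          _ ≤ 2 * C₁ * Real.exp (-(ξ + w)) * (C₀ * (((2 + w) * |w - l|) * M)) := by
              gcongr
              exact hd.trans (by gcongr)
          _ = |w - l| * (2 * C₁ * Real.exp (-ξ) * C₀ * ((2 + w) * Real.exp (-w)) * M) := by
              rw [hexp]; ring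
          _ ≤ |w - l| * (E * ((2 + w) * Real.exp (-w)) * M) := by
              rw [hE]; gcongr; linarith
      exact le_of_mul_le_mul_left h4 (by linarith)
  have hE0 : 0 < E := by positivity
  refine ⟨2 * E, by positivity, fun w l hw hl => (hmain w l hw hl).trans ?_⟩
  have h5 : (2 + w) * Real.exp (-w) ≤ 2 * Real.exp (-w / 2) := by
    have h6 : w / 2 + 1 ≤ Real.exp (w / 2) := Real.add_one_le_exp _
    have h7 : Real.exp (-w / 2) = Real.exp (w / 2) * Real.exp (-w) := by
      rw [← Real.exp_add]; ring_nf
    rw [h7]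
    have := Real.exp_pos (-w)
    nlinarith
  have : E * ((2 + w) * Real.exp (-w)) ≤ 2 * E * Real.exp (-w / 2) := by nlinarith
  gcongr

lemma continuous_airyKer_section (ξ w : ℝ) : Continuous fun l => airyKer (ξ + w) (ξ + l) := by
  have h : Continuous fun l : ℝ => (ξ + w, ξ + l) := by fun_prop
  have h2 := continuous_airyKer.comp h
  simp only [Function.comp_def] at h2
  exact h2

lemma integrable_airyKer_mul_airyKer (ξ w y : ℝ) :
    Integrable (fun l => airyKer (ξ + w) (ξ + l) * airyKer (ξ + l) (ξ + y))
      (volume.restrict (Ioi (0 : ℝ))) := by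
  obtain ⟨C, hC, hb⟩ := exists_airyKer_bound
  have hc : Continuous fun l => airyKer (ξ + w) (ξ + l) * airyKer (ξ + l) (ξ + y) := by
    have h := continuous_airyKer_section ξ y
    simp_rw [airyKer_symm (ξ + y)] at h
    exact (continuous_airyKer_section ξ w).mul h
  refine Integrable.mono' ((integrableOn_exp_mul_Ioi (a := -2) (by norm_num) 0).const_mul
    (C ^ 2 * Real.exp (-(ξ + w) - ξ - ξ - (ξ + y)))) hc.aestronglyMeasurable
    (Eventually.of_forall fun l => ?_)
  rw [Real.norm_eq_abs, abs_mul]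
  calc _ ≤ (C * Real.exp (-(ξ + w) - (ξ + l))) * (C * Real.exp (-(ξ + l) - (ξ + y))) := by
        gcongr
        exacts [hb _ _, hb _ _]
    _ = C ^ 2 * (Real.exp (-(ξ + w) - (ξ + l)) * Real.exp (-(ξ + l) - (ξ + y))) := by ring
    _ = _ := by rw [mul_assoc, ← Real.exp_add, ← Real.exp_add]; ring_nf

/-- A pointwise solution of the resolvent equation, with no integrability assumed, is
automatically measurable and exponentially decaying. -/
lemma resolvent_section_regular (ξ y : ℝ) {r : ℝ → ℝ}
    (hr : ∀ w, 0 < w → r w = airyKer (ξ + w) (ξ + y) +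
      ∫ l in Ioi (0 : ℝ), airyKer (ξ + w) (ξ + l) * r l) :
    AEStronglyMeasurable r (volume.restrict (Ioi (0 : ℝ))) ∧
      ∃ C : ℝ, ∀ w, 0 < w → |r w| ≤ C * Real.exp (-w / 2) := by
  by_cases hAi : ∃ x, Ai x ≠ 0
  swap
  · push Not at hAi
    have hK : ∀ a b, airyKer a b = 0 := fun a b => by simp [airyKer, hAi]
    have hr0 : ∀ w, 0 < w → r w = 0 := fun w hw => by simp [hr w hw, hK]
    refine ⟨(aestronglyMeasurable_const (b := (0 : ℝ))).congr ?_, 0, fun w hw => by simp [hr0 w hw]⟩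
    filter_upwards [ae_restrict_mem measurableSet_Ioi] with w hw
    exact (hr0 w hw).symm
  set S : Set ℝ := {w | 0 < w ∧
    Integrable (fun l => airyKer (ξ + w) (ξ + l) * r l) (volume.restrict (Ioi (0 : ℝ)))} with hS
  have hSpos : volume S ≠ 0 := by
    intro h0
    have hae : ∀ᵐ l ∂volume.restrict (Ioi (0 : ℝ)), r l = airyKer (ξ + l) (ξ + y) := by
      have h1 : ∀ᵐ l ∂volume.restrict (Ioi (0 : ℝ)), l ∉ S :=
        ae_restrict_of_ae (measure_eq_zero_iff_ae_notMem.mp h0)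
      filter_upwards [h1, ae_restrict_mem measurableSet_Ioi] with l hl hl0
      rw [hr l hl0, integral_undef, add_zero]
      exact fun hi => hl ⟨hl0, hi⟩
    have hsub : Ioi (0 : ℝ) ⊆ S := fun w hw =>
      ⟨hw, (integrable_airyKer_mul_airyKer ξ w y).congr (hae.mono fun l hl => by simp only [hl])⟩
    have := measure_mono_null hsub h0
    simp at this
  obtain ⟨p, hpS, hp⟩ := exists_mem_forall_mem_nhdsWithin_pos_measure hSpos
  obtain ⟨q, hqS, hpq, hKpq⟩ : ∃ q ∈ S, p ≠ q ∧ airyKer (ξ + p) (ξ + q) ≠ 0 := by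
    have hnhds : {q | 0 < airyKer (ξ + p) (ξ + q)} ∈ 𝓝 p :=
      (continuous_airyKer_section ξ p).continuousAt.eventually
        (lt_mem_nhds (airyKer_self_pos hAi _))
    have hm := hp _ (inter_mem_nhdsWithin S hnhds)
    by_contra! hcon
    have hsub : S ∩ {q | 0 < airyKer (ξ + p) (ξ + q)} ⊆ {p} := by
      rintro q ⟨hqS, hq⟩
      by_contra hne
      exact (ne_of_gt hq) (hcon q hqS (fun h => hne h.symm))
    exact hm.ne' (measure_mono_null hsub (by simp))
  obtain ⟨C₀, hC₀, hdata⟩ := exists_airyData_le ξ hpq hKpq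
  obtain ⟨C₁, hC₁, hsec⟩ := exists_airyKer_le_sections ξ hpq hKpq
  have hMpos : ∀ l, 0 < l → 0 < airyKer (ξ + p) (ξ + l) ^ 2 + airyKer (ξ + q) (ξ + l) ^ 2 := by
    intro l hl
    by_contra hle
    have h1 : airyKer (ξ + p) (ξ + l) = 0 := by nlinarith [sq_nonneg (airyKer (ξ + p) (ξ + l)), sq_nonneg (airyKer (ξ + q) (ξ + l))]
    have h2 : airyKer (ξ + q) (ξ + l) = 0 := by nlinarith [sq_nonneg (airyKer (ξ + p) (ξ + l)), sq_nonneg (airyKer (ξ + q) (ξ + l))]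
    have h3 := hdata l hl
    rw [h1, h2] at h3
    simp only [abs_zero, add_zero, mul_zero] at h3
    have h4 : Ai (ξ + l) = 0 := abs_eq_zero.mp (by linarith [abs_nonneg (Ai (ξ + l)), abs_nonneg (AiDeriv (ξ + l))])
    have h5 : AiDeriv (ξ + l) = 0 := abs_eq_zero.mp (by linarith [abs_nonneg (Ai (ξ + l)), abs_nonneg (AiDeriv (ξ + l))])
    obtain ⟨x, hx⟩ := hAi
    exact hx (Ai_eq_zero_of_airyEnergy_eq_zero (b := ξ + l) (by rw [airyEnergy, h4, h5]; norm_num) x)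
  have hmeas : AEStronglyMeasurable r (volume.restrict (Ioi (0 : ℝ))) := by
    have hcp := (continuous_airyKer_section ξ p)
    have hcq := (continuous_airyKer_section ξ q)
    have h1 := ((hcp.aestronglyMeasurable (μ := volume.restrict (Ioi (0 : ℝ)))).mul hpS.2.1).add
      (hcq.aestronglyMeasurable.mul hqS.2.1)
    have h2 : AEMeasurable (fun l => (airyKer (ξ + p) (ξ + l) ^ 2 + airyKer (ξ + q) (ξ + l) ^ 2)⁻¹)
      (volume.restrict (Ioi (0 : ℝ))) := ((hcp.pow 2).add (hcq.pow 2)).measurable.inv.aemeasurable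
    refine (h1.mul h2.aestronglyMeasurable).congr ?_
    filter_upwards [ae_restrict_mem measurableSet_Ioi] with l hl
    have := (hMpos l hl).ne'
    simp only [Pi.mul_apply, Pi.add_apply]
    field_simp
  have hMint : Integrable (fun l => (|airyKer (ξ + p) (ξ + l)| + |airyKer (ξ + q) (ξ + l)|) * |r l|)
      (volume.restrict (Ioi (0 : ℝ))) := by
    refine (hpS.2.abs.add hqS.2.abs).congr (Eventually.of_forall fun l => ?_)
    simp only [Pi.add_apply, abs_mul]
    ring
  obtain ⟨C₂, hC₂, hb⟩ := exists_airyKer_bound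
  refine ⟨hmeas, C₂ * Real.exp (-ξ - (ξ + y)) + C₁ *
    ∫ l in Ioi (0 : ℝ), (|airyKer (ξ + p) (ξ + l)| + |airyKer (ξ + q) (ξ + l)|) * |r l|,
    fun w hw => ?_⟩
  have h1 : |∫ l in Ioi (0 : ℝ), airyKer (ξ + w) (ξ + l) * r l| ≤ C₁ * Real.exp (-w / 2) *
      ∫ l in Ioi (0 : ℝ), (|airyKer (ξ + p) (ξ + l)| + |airyKer (ξ + q) (ξ + l)|) * |r l| := by
    rw [← integral_const_mul, ← Real.norm_eq_abs]
    refine norm_integral_le_of_norm_le (hMint.const_mul _) ?_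
    filter_upwards [ae_restrict_mem measurableSet_Ioi] with l hl
    rw [Real.norm_eq_abs, abs_mul, ← mul_assoc]
    gcongr
    exact hsec w l hw hl
  have h2 : |airyKer (ξ + w) (ξ + y)| ≤ C₂ * Real.exp (-ξ - (ξ + y)) * Real.exp (-w / 2) := by
    refine (hb _ _).trans ?_
    rw [mul_assoc, ← Real.exp_add]
    gcongr
    linarith
  rw [hr w hw]
  refine (abs_add_le _ _).trans ?_
  linarith

lemma sq_det_le_of_abs_le_one {n : ℕ} (M : Matrix (Fin n) (Fin n) ℝ) (hM : ∀ i j, |M i j| ≤ 1) :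
    M.det ^ 2 ≤ (n : ℝ) ^ n := by
  rcases Nat.eq_zero_or_pos n with rfl | hn
  · simp
  have hP := Matrix.posSemidef_self_mul_conjTranspose M
  have hdet : M.det ^ 2 = ∏ i, hP.isHermitian.eigenvalues i := by
    have := hP.isHermitian.det_eq_prod_eigenvalues
    rw [Matrix.det_mul, Matrix.det_conjTranspose] at this
    simp only [star_trivial, RCLike.ofReal_real_eq_id, id_eq] at this
    rw [sq, this]
  have htr : ∑ i, hP.isHermitian.eigenvalues i ≤ (n : ℝ) ^ 2 := by
    have := hP.isHermitian.trace_eq_sum_eigenvalues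
    simp only [RCLike.ofReal_real_eq_id, id_eq] at this
    rw [← this, Matrix.trace]
    calc _ ≤ ∑ i : Fin n, ∑ j : Fin n, (1 : ℝ) := by
          refine Finset.sum_le_sum fun i _ => ?_
          rw [Matrix.diag_apply, Matrix.mul_apply]
          refine Finset.sum_le_sum fun j _ => ?_
          simp only [Matrix.conjTranspose_apply, star_trivial]
          have := hM i j
          nlinarith [abs_mul_abs_self (M i j), abs_nonneg (M i j)]
      _ = (n : ℝ) ^ 2 := by simp [sq]
  have hnn := hP.eigenvalues_nonneg
  have hn' : (0 : ℝ) < n := by exact_mod_cast hn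
  have h := Real.geom_mean_le_arith_mean_weighted Finset.univ (fun _ : Fin n => (n : ℝ)⁻¹)
    hP.isHermitian.eigenvalues (fun _ _ => by positivity) (by simp [hn'.ne']) (fun i _ => hnn i)
  rw [← Finset.mul_sum, Real.finsetProd_rpow _ _ (fun i _ => hnn i), ← hdet] at h
  have h2 : (M.det ^ 2) ^ (n : ℝ)⁻¹ ≤ n := h.trans (by
    rw [inv_mul_le_iff₀ hn']; nlinarith)
  calc M.det ^ 2 = ((M.det ^ 2) ^ (n : ℝ)⁻¹) ^ n := by
        rw [Real.rpow_inv_natCast_pow (sq_nonneg _) hn.ne']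
    _ ≤ _ := by gcongr

/-- The Hadamard factor `√(n ^ n)`. -/
noncomputable def hadamardFactor (n : ℕ) : ℝ := Real.sqrt ((n : ℝ) ^ n)

lemma hadamardFactor_nonneg (n : ℕ) : 0 ≤ hadamardFactor n := Real.sqrt_nonneg _

lemma abs_det_le_hadamardFactor {n : ℕ} (M : Matrix (Fin n) (Fin n) ℝ) {C : ℝ} (hC : 0 < C)
    {u v : Fin n → ℝ} (hu : ∀ i, 0 < u i) (hv : ∀ i, 0 < v i)
    (hM : ∀ i j, |M i j| ≤ C * (u i * v j)) :
    |M.det| ≤ C ^ n * hadamardFactor n * ((∏ i, u i) * ∏ i, v i) := by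
  set N : Matrix (Fin n) (Fin n) ℝ := Matrix.of fun i j => M i j / (C * (u i * v j)) with hN
  have hN1 : |N.det| ≤ hadamardFactor n := by
    refine Real.abs_le_sqrt (sq_det_le_of_abs_le_one N fun i j => ?_)
    have : 0 < C * (u i * v j) := mul_pos hC (mul_pos (hu i) (hv j))
    rw [hN, Matrix.of_apply, abs_div, abs_of_pos this, div_le_one this]
    exact hM i j
  have hMN : M = Matrix.of fun i j => (C * u i) *
      (Matrix.of fun i j => v j * N i j : Matrix (Fin n) (Fin n) ℝ) i j := by
    ext i j
    have := (hu i).ne'; have := (hv j).ne'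
    simp only [hN, Matrix.of_apply]
    field_simp
  rw [hMN, Matrix.det_mul_column, Matrix.det_mul_row, Finset.prod_mul_distrib, Finset.prod_const,
    Finset.card_univ, Fintype.card_fin, abs_mul, abs_mul, abs_mul, abs_of_pos (pow_pos hC n),
    abs_of_pos (Finset.prod_pos fun i _ => hu i), abs_of_pos (Finset.prod_pos fun i _ => hv i)]
  have h1 := Finset.prod_pos fun i (_ : i ∈ Finset.univ) => hu i
  have h2 := Finset.prod_pos fun i (_ : i ∈ Finset.univ) => hv i
  calc _ = C ^ n * |N.det| * ((∏ i, u i) * ∏ i, v i) := by ring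
    _ ≤ _ := by gcongr

lemma hadamardFactor_term_le (C : ℝ) (n : ℕ) :
    (1 / (n.factorial : ℝ)) * (C ^ n * hadamardFactor n) ≤
      Real.sqrt (Real.exp (16 * Real.exp 1 * C ^ 2)) * (1 / 4) ^ n := by
  have hf : (0 : ℝ) < n.factorial := by exact_mod_cast n.factorial_pos
  have h1 : (n : ℝ) ^ n / n.factorial ≤ Real.exp n := Real.pow_div_factorial_le_exp _ (by positivity) n
  have h2 : (16 * Real.exp 1 * C ^ 2) ^ n / n.factorial ≤ Real.exp (16 * Real.exp 1 * C ^ 2) :=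
    Real.pow_div_factorial_le_exp _ (by positivity) n
  rw [← Real.sqrt_sq (by positivity : (0:ℝ) ≤ (1 / 4) ^ n), ← Real.sqrt_mul (Real.exp_pos _).le]
  refine Real.le_sqrt_of_sq_le ?_
  have hs : hadamardFactor n ^ 2 = (n : ℝ) ^ n := Real.sq_sqrt (by positivity)
  have he : Real.exp n = Real.exp 1 ^ n := by rw [← Real.exp_nat_mul, mul_one]
  calc (1 / (n.factorial : ℝ) * (C ^ n * hadamardFactor n)) ^ 2
      = (C ^ 2) ^ n / n.factorial * ((n : ℝ) ^ n / n.factorial) := by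
        rw [mul_pow, mul_pow, hs]; ring
    _ ≤ (C ^ 2) ^ n / n.factorial * Real.exp 1 ^ n := by rw [← he]; gcongr
    _ = (16 * Real.exp 1 * C ^ 2) ^ n / n.factorial * (((1 / 4) ^ n) ^ 2) := by
        rw [mul_pow, mul_pow, ← pow_mul (1 / 4 : ℝ), mul_comm n 2, pow_mul (1 / 4 : ℝ)]
        have : (16 : ℝ) ^ n * ((1 / 4) ^ 2) ^ n = 1 := by rw [← mul_pow]; norm_num
        linear_combination (-(C ^ 2) ^ n / n.factorial * Real.exp 1 ^ n) * this
    _ ≤ _ := by gcongr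

lemma summable_mul_hadamardFactor {C : ℝ} (hC : 0 ≤ C) :
    Summable fun n : ℕ => (1 / (n.factorial : ℝ)) * (n * (C ^ n * hadamardFactor n)) := by
  refine Summable.of_nonneg_of_le (fun n => by have := hadamardFactor_nonneg n; positivity)
    (fun n => ?_) ((summable_geometric_of_lt_one (by norm_num : (0 : ℝ) ≤ 1 / 2)
      (by norm_num)).mul_left (Real.sqrt (Real.exp (16 * Real.exp 1 * C ^ 2))))
  have h := hadamardFactor_term_le C n
  have h2 : (n : ℝ) ≤ 2 ^ n := by exact_mod_cast Nat.lt_two_pow_self.le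
  calc _ = n * ((1 / (n.factorial : ℝ)) * (C ^ n * hadamardFactor n)) := by ring
    _ ≤ 2 ^ n * (Real.sqrt (Real.exp (16 * Real.exp 1 * C ^ 2)) * (1 / 4) ^ n) := by
      have := hadamardFactor_nonneg n
      gcongr
    _ = _ := by
      have : (2 : ℝ) ^ n * (1 / 4) ^ n = (1 / 2) ^ n := by rw [← mul_pow]; norm_num
      rw [← this]; ring

lemma summable_hadamardFactor {C : ℝ} (hC : 0 ≤ C) :
    Summable fun n : ℕ => (1 / (n.factorial : ℝ)) * (C ^ n * hadamardFactor n) := by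
  refine Summable.of_nonneg_of_le (fun n => by have := hadamardFactor_nonneg n; positivity)
    (fun n => hadamardFactor_term_le C n)
    ((summable_geometric_of_lt_one (by norm_num) (by norm_num)).mul_left _)

lemma summable_hadamardFactor_succ {C : ℝ} (hC : 0 ≤ C) :
    Summable fun n : ℕ => (1 / (n.factorial : ℝ)) * (C ^ (n + 1) * hadamardFactor (n + 1)) := by
  refine ((summable_nat_add_iff 1).2 (summable_mul_hadamardFactor hC)).congr fun n => ?_
  rw [Nat.factorial_succ]
  push_cast
  field_simp

lemma hasDerivAt_det {n : ℕ} {M : ℝ → Matrix (Fin n) (Fin n) ℝ} {M' : Matrix (Fin n) (Fin n) ℝ}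
    {t : ℝ} (h : ∀ i j, HasDerivAt (fun s => M s i j) (M' i j) t) :
    HasDerivAt (fun s => (M s).det) (∑ i, ((M t).updateRow i (M' i)).det) t := by
  let D : ContinuousMultilinearMap ℝ (fun _ : Fin n => Fin n → ℝ) ℝ :=
    { (Matrix.detRowAlternating : (Fin n → ℝ) [⋀^Fin n]→ₗ[ℝ] ℝ).toMultilinearMap with
      cont := (continuous_id (X := Matrix (Fin n) (Fin n) ℝ)).matrix_det }
  have hg : ∀ i, HasFDerivAt (fun s => M s i) (ContinuousLinearMap.toSpanSingleton ℝ (M' i)) t :=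
    fun i => (hasDerivAt_pi.2 (h i)).hasFDerivAt
  have := (HasFDerivAt.multilinear_comp (f := D) hg).hasDerivAt
  refine HasDerivAt.congr_deriv (f := fun s => (M s).det) this ?_
  rw [sum_apply]
  refine Finset.sum_congr rfl fun i _ => ?_
  simp only [ContinuousLinearMap.comp_apply, ContinuousLinearMap.toSpanSingleton_apply, one_smul]
  rfl

/-- The determinant of `L` evaluated at the points `z`. -/
noncomputable def fredDet (L : ℝ → ℝ → ℝ) (n : ℕ) (z : Fin n → ℝ) : ℝ :=
  Matrix.det (Matrix.of fun i j => L (z i) (z j))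

/-- The determinant of `L` at the points `z` with the first row replaced by the values of `a`. -/
noncomputable def borderedDet (a : ℝ → ℝ) (L : ℝ → ℝ → ℝ) (m : ℕ) (z : Fin (m + 1) → ℝ) : ℝ :=
  Matrix.det (Matrix.of fun i j : Fin (m + 1) =>
    (Fin.cases (a (z j)) (fun k => L (z k.succ) (z j)) i : ℝ))

lemma borderedDet_cons (a : ℝ → ℝ) (L : ℝ → ℝ → ℝ) (m : ℕ) (y : ℝ) (x : Fin (m + 1) → ℝ) :
    borderedDet a L (m + 1) (Fin.cons y x) = a y * fredDet L (m + 1) x -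
      ∑ k : Fin (m + 1), L (x k) y * borderedDet a L m (x ∘ k.cycleRange.symm) := by
  unfold borderedDet fredDet
  rw [Matrix.det_succ_column_zero, Fin.sum_univ_succ, sub_eq_add_neg, ← Finset.sum_neg_distrib]
  congr 1
  · simp only [Fin.val_zero, pow_zero, one_mul, Matrix.of_apply, Fin.cases_zero, Fin.cons_zero]
    congr 1
  · refine Finset.sum_congr rfl fun k _ => ?_
    have h : (Matrix.of fun i j : Fin (m + 1) => (Fin.cases (a ((x ∘ k.cycleRange.symm) j))
          (fun l => L ((x ∘ k.cycleRange.symm) l.succ) ((x ∘ k.cycleRange.symm) j)) i : ℝ)) =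
        ((Matrix.of fun i j : Fin (m + 2) => (Fin.cases (a ((Fin.cons y x : Fin (m + 2) → ℝ) j))
          (fun l => L ((Fin.cons y x : Fin (m + 2) → ℝ) l.succ) ((Fin.cons y x : Fin (m + 2) → ℝ) j))
          i : ℝ)).submatrix k.succ.succAbove Fin.succ).submatrix id k.cycleRange.symm := by
      ext i j
      refine Fin.cases ?_ (fun l => ?_) i
      · simp
      · simp [Fin.cycleRange_symm_succ]
    rw [h, Matrix.det_permute', Equiv.Perm.sign_symm, Fin.sign_cycleRange]
    simp only [Fin.val_succ, Matrix.of_apply, Fin.cases_succ, Fin.cons_succ, Fin.cons_zero]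
    have : ((-1 : ℝ) ^ (k : ℕ)) * (-1) ^ (k : ℕ) = 1 := by rw [← mul_pow]; norm_num
    push_cast
    ring

lemma hasDerivAt_fredDet {L : ℝ → ℝ → ℝ → ℝ} {a : ℝ → ℝ} {t : ℝ} {n : ℕ} (z : Fin (n + 1) → ℝ)
    (h : ∀ x y, HasDerivAt (fun s => L s x y) (a x * a y) t) :
    HasDerivAt (fun s => fredDet (L s) (n + 1) z)
      (∑ i, a (z i) * borderedDet a (L t) n (z ∘ i.cycleRange.symm)) t := by
  refine (hasDerivAt_det (M := fun s => Matrix.of fun i j => L s (z i) (z j))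
    (M' := Matrix.of fun i j => a (z i) * a (z j)) (fun i j => h _ _)).congr_deriv ?_
  refine Finset.sum_congr rfl fun i _ => ?_
  have : (Matrix.of fun i j => a (z i) * a (z j) : Matrix (Fin (n + 1)) (Fin (n + 1)) ℝ) i =
      a (z i) • fun j => a (z j) := by ext j; simp
  rw [this, Matrix.det_updateRow_smul]
  congr 1
  rw [borderedDet, ← Matrix.det_submatrix_equiv_self i.cycleRange.symm]
  congr 1
  ext p q
  refine Fin.cases ?_ (fun l => ?_) p
  · simp
  · simp [Fin.cycleRange_symm_succ, Matrix.updateRow_ne]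

/-- Lebesgue measure on `(0, ∞)`. -/
noncomputable abbrev halfLine : Measure ℝ := volume.restrict (Ioi 0)

/-- The product of `n` copies of Lebesgue measure on `(0, ∞)`. -/
noncomputable abbrev halfLinePi (n : ℕ) : Measure (Fin n → ℝ) := Measure.pi fun _ => halfLine

lemma restrict_forall_pos_eq (n : ℕ) :
    (volume : Measure (Fin n → ℝ)).restrict {x | ∀ i, 0 < x i} = halfLinePi n := by
  have : {x : Fin n → ℝ | ∀ i, 0 < x i} = Set.univ.pi fun _ => Ioi 0 := by ext; simp
  rw [this, volume_pi, Measure.restrict_pi_pi]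

/-- The weight dominating all Fredholm determinants. -/
noncomputable def fredWeight (n : ℕ) (z : Fin n → ℝ) : ℝ := ∏ i, Real.exp (-2 * z i)

lemma integrable_exp_neg_two_halfLine : Integrable (fun x => Real.exp (-2 * x)) halfLine :=
  integrableOn_exp_mul_Ioi (by norm_num) 0

lemma integrable_fredWeight (n : ℕ) : Integrable (fredWeight n) (halfLinePi n) :=
  Integrable.fintype_prod (f := fun _ : Fin n => fun x : ℝ => Real.exp (-2 * x))
    fun _ => integrable_exp_neg_two_halfLine

lemma integral_fredWeight_le (n : ℕ) : ∫ z, fredWeight n z ∂halfLinePi n ≤ 1 := by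
  have h := integral_fintype_prod_eq_prod (fun _ : Fin n => fun x : ℝ => Real.exp (-2 * x))
    (μ := fun _ => halfLine)
  have h2 : ∫ x in Ioi (0 : ℝ), Real.exp (-2 * x) = 1 / 2 := by
    rw [integral_exp_mul_Ioi (by norm_num)]; norm_num
  change (∫ z, fredWeight n z ∂halfLinePi n) = _ at h
  rw [h, h2]
  exact Finset.prod_le_one (fun _ _ => by norm_num) fun _ _ => by norm_num

lemma fredWeight_comp_perm (n : ℕ) (z : Fin n → ℝ) (σ : Equiv.Perm (Fin n)) :
    fredWeight n (z ∘ σ) = fredWeight n z :=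
  Equiv.prod_comp σ fun i => Real.exp (-2 * z i)

lemma integral_halfLinePi_succ {n : ℕ} (i : Fin (n + 1)) {ψ : (Fin (n + 1) → ℝ) → ℝ}
    (hψ : Integrable ψ (halfLinePi (n + 1))) :
    ∫ z, ψ z ∂halfLinePi (n + 1) =
      ∫ u, ∫ x, ψ (i.insertNth u x) ∂halfLinePi n ∂halfLine := by
  have e := (measurePreserving_piFinSuccAbove (fun _ : Fin (n + 1) => halfLine) i).symm
  rw [← e.integral_comp' (g := ψ), integral_prod]
  · rfl
  · exact (e.integrable_comp_emb (MeasurableEquiv.measurableEmbedding _)).2 hψ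

/-- Continuity and exponential decay of a kernel `L` and a function `a`. -/
structure DecayData (a : ℝ → ℝ) (L : ℝ → ℝ → ℝ) (C : ℝ) : Prop where
  pos : 0 < C
  continuous_fun : Continuous a
  continuous_kernel : Continuous fun p : ℝ × ℝ => L p.1 p.2
  bound_fun : ∀ x, |a x| ≤ C * Real.exp (-x)
  bound_kernel : ∀ x y, |L x y| ≤ C * (Real.exp (-x) * Real.exp (-y))

namespace DecayData

variable {a : ℝ → ℝ} {L : ℝ → ℝ → ℝ} {C : ℝ}

lemma continuous_kernel_comp (h : DecayData a L C) {X : Type*} [TopologicalSpace X] {f g : X → ℝ}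
    (hf : Continuous f) (hg : Continuous g) : Continuous fun x => L (f x) (g x) :=
  h.continuous_kernel.comp (hf.prodMk hg)

lemma continuous_fredDet (h : DecayData a L C) (n : ℕ) : Continuous (fredDet L n) := by
  refine Continuous.matrix_det (continuous_matrix fun i j => ?_)
  exact h.continuous_kernel_comp (continuous_apply i) (continuous_apply j)

lemma continuous_borderedDet (h : DecayData a L C) (m : ℕ) : Continuous (borderedDet a L m) := by
  refine Continuous.matrix_det (continuous_matrix fun i j => ?_)
  refine Fin.cases ?_ (fun k => ?_) i
  · exact h.continuous_fun.comp (continuous_apply j)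
  · exact h.continuous_kernel_comp (continuous_apply k.succ) (continuous_apply j)

lemma abs_fredDet_le (h : DecayData a L C) (n : ℕ) (z : Fin n → ℝ) :
    |fredDet L n z| ≤ C ^ n * hadamardFactor n * fredWeight n z := by
  refine (abs_det_le_hadamardFactor _ h.pos (u := fun i => Real.exp (-z i))
    (v := fun i => Real.exp (-z i)) (fun _ => Real.exp_pos _) (fun _ => Real.exp_pos _)
    fun i j => h.bound_kernel _ _).trans_eq ?_
  rw [fredWeight, ← Finset.prod_mul_distrib]
  congr 2 with i
  rw [← Real.exp_add]; ring_nf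

lemma abs_borderedDet_cons_le (h : DecayData a L C) (m : ℕ) (y : ℝ) (x : Fin m → ℝ) :
    |borderedDet a L m (Fin.cons y x)| ≤
      C ^ (m + 1) * hadamardFactor (m + 1) * (Real.exp (-y) * fredWeight m x) := by
  refine (abs_det_le_hadamardFactor _ h.pos
    (u := fun i : Fin (m + 1) => (Fin.cases 1 (fun k => Real.exp (-x k)) i : ℝ))
    (v := fun i => Real.exp (-(Fin.cons y x : Fin (m + 1) → ℝ) i)) (fun i => ?_)
    (fun _ => Real.exp_pos _) fun i j => ?_).trans_eq ?_
  · refine Fin.cases ?_ (fun k => ?_) i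
    · simp
    · simpa using Real.exp_pos _
  · refine Fin.cases ?_ (fun k => ?_) i
    · simpa using h.bound_fun _
    · simpa using h.bound_kernel (x k) _
  · rw [Fin.prod_univ_succ, Fin.prod_univ_succ]
    simp only [Fin.cases_zero, Fin.cases_succ, Fin.cons_zero, Fin.cons_succ, one_mul]
    have : fredWeight m x = (∏ k, Real.exp (-x k)) * ∏ k, Real.exp (-x k) := by
      rw [fredWeight, ← Finset.prod_mul_distrib]
      congr 1 with i
      rw [← Real.exp_add]; ring_nf
    rw [this]; ring

lemma abs_mul_borderedDet_le (h : DecayData a L C) {φ : ℝ → ℝ} {D : ℝ}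
    (hφ : ∀ u, |φ u| ≤ D * Real.exp (-u)) (m : ℕ) (z : Fin (m + 1) → ℝ) :
    |φ (z 0) * borderedDet a L m z| ≤
      D * (C ^ (m + 1) * hadamardFactor (m + 1)) * fredWeight (m + 1) z := by
  have h1 := h.abs_borderedDet_cons_le m (z 0) (Fin.tail z)
  rw [Fin.cons_self_tail] at h1
  rw [abs_mul]
  refine (mul_le_mul (hφ _) h1 (abs_nonneg _) ((abs_nonneg _).trans (hφ _))).trans_eq ?_
  have : fredWeight (m + 1) z = Real.exp (-z 0) * Real.exp (-z 0) * fredWeight m (Fin.tail z) := by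
    rw [fredWeight, Fin.prod_univ_succ, ← Real.exp_add, fredWeight]
    congr 2
    ring
  rw [this]; ring

end DecayData

/-- The integral of the `n`-point determinant. -/
noncomputable def fredInt (L : ℝ → ℝ → ℝ) (n : ℕ) : ℝ := ∫ z, fredDet L n z ∂halfLinePi n

/-- The integral of the bordered determinant over all but the first point. -/
noncomputable def borderedInt (a : ℝ → ℝ) (L : ℝ → ℝ → ℝ) (m : ℕ) (y : ℝ) : ℝ :=
  ∫ x : Fin m → ℝ, borderedDet a L m (Fin.cons y x) ∂halfLinePi m

namespace DecayData

variable {a : ℝ → ℝ} {L : ℝ → ℝ → ℝ} {C : ℝ}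

lemma integrable_fredDet (h : DecayData a L C) (n : ℕ) :
    Integrable (fredDet L n) (halfLinePi n) :=
  ((integrable_fredWeight n).const_mul _).mono' (h.continuous_fredDet n).aestronglyMeasurable
    (ae_of_all _ fun z => h.abs_fredDet_le n z)

lemma abs_fredInt_le (h : DecayData a L C) (n : ℕ) : |fredInt L n| ≤ C ^ n * hadamardFactor n := by
  have hC := h.pos
  have hn := hadamardFactor_nonneg n
  refine (norm_integral_le_of_norm_le (f := fredDet L n) ((integrable_fredWeight n).const_mul _)
    (ae_of_all _ fun z => h.abs_fredDet_le n z)).trans ?_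
  rw [integral_const_mul]
  exact mul_le_of_le_one_right (by positivity) (integral_fredWeight_le n)

lemma continuous_borderedDet_cons (h : DecayData a L C) (m : ℕ) :
    Continuous fun p : ℝ × (Fin m → ℝ) => borderedDet a L m (Fin.cons p.1 p.2) := by
  refine (h.continuous_borderedDet m).comp (continuous_pi fun i => ?_)
  refine Fin.cases ?_ (fun k => ?_) i
  · simpa using continuous_fst
  · simp only [Fin.cons_succ]; fun_prop

lemma abs_borderedInt_le (h : DecayData a L C) (m : ℕ) (y : ℝ) :
    |borderedInt a L m y| ≤ C ^ (m + 1) * hadamardFactor (m + 1) * Real.exp (-y) := by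
  have hC := h.pos
  have hn := hadamardFactor_nonneg (m + 1)
  refine (norm_integral_le_of_norm_le
    (f := fun x : Fin m → ℝ => borderedDet a L m (Fin.cons y x)) (((integrable_fredWeight m).const_mul _).const_mul _)
    (ae_of_all _ fun x => h.abs_borderedDet_cons_le m y x)).trans ?_
  rw [integral_const_mul, integral_const_mul]
  refine mul_le_mul_of_nonneg_left ?_ (by positivity)
  exact mul_le_of_le_one_right (Real.exp_pos _).le (integral_fredWeight_le m)

lemma stronglyMeasurable_borderedInt (h : DecayData a L C) (m : ℕ) :
    StronglyMeasurable (borderedInt a L m) :=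
  (h.continuous_borderedDet_cons m).stronglyMeasurable.integral_prod_right

section weighted

variable {φ : ℝ → ℝ} {D : ℝ}

lemma abs_mul_borderedDet_comp_perm_le (h : DecayData a L C)
    (hφ : ∀ u, |φ u| ≤ D * Real.exp (-u)) (m : ℕ) (i : Fin (m + 1)) (z : Fin (m + 1) → ℝ) :
    |φ (z i) * borderedDet a L m (z ∘ i.cycleRange.symm)| ≤
      D * (C ^ (m + 1) * hadamardFactor (m + 1)) * fredWeight (m + 1) z := by
  have := h.abs_mul_borderedDet_le hφ m (z ∘ i.cycleRange.symm)
  rw [fredWeight_comp_perm, Function.comp_apply] at this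
  simpa using this

lemma integrable_mul_borderedDet (h : DecayData a L C) (hφc : Continuous φ)
    (hφ : ∀ u, |φ u| ≤ D * Real.exp (-u)) (m : ℕ) (i : Fin (m + 1)) :
    Integrable (fun z => φ (z i) * borderedDet a L m (z ∘ i.cycleRange.symm))
      (halfLinePi (m + 1)) := by
  refine ((integrable_fredWeight (m + 1)).const_mul _).mono' (Continuous.aestronglyMeasurable ?_)
    (ae_of_all _ fun z => h.abs_mul_borderedDet_comp_perm_le hφ m i z)
  exact (hφc.comp (continuous_apply i)).mul ((h.continuous_borderedDet m).comp
    (continuous_pi fun j => continuous_apply _))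

lemma integral_mul_borderedDet (h : DecayData a L C) (hφc : Continuous φ)
    (hφ : ∀ u, |φ u| ≤ D * Real.exp (-u)) (m : ℕ) (i : Fin (m + 1)) :
    ∫ z, φ (z i) * borderedDet a L m (z ∘ i.cycleRange.symm) ∂halfLinePi (m + 1) =
      ∫ u, φ u * borderedInt a L m u ∂halfLine := by
  rw [integral_halfLinePi_succ i (h.integrable_mul_borderedDet hφc hφ m i)]
  refine integral_congr_ae (ae_of_all _ fun u => ?_)
  simp only [Fin.insertNth_apply_same, Fin.insertNth_comp_cycleRange_symm, borderedInt]
  rw [← integral_const_mul]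

lemma integral_sum_mul_borderedDet (h : DecayData a L C) (hφc : Continuous φ)
    (hφ : ∀ u, |φ u| ≤ D * Real.exp (-u)) (m : ℕ) :
    ∫ z, ∑ i : Fin (m + 1), φ (z i) * borderedDet a L m (z ∘ i.cycleRange.symm)
        ∂halfLinePi (m + 1) =
      (m + 1) * ∫ u, φ u * borderedInt a L m u ∂halfLine := by
  rw [integral_finsetSum _ fun i _ => h.integrable_mul_borderedDet hφc hφ m i]
  simp [h.integral_mul_borderedDet hφc hφ]

end weighted

lemma borderedInt_zero (y : ℝ) : borderedInt a L 0 y = a y := by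
  simp [borderedInt, borderedDet, Measure.real]

lemma borderedInt_succ (h : DecayData a L C) (m : ℕ) (y : ℝ) :
    borderedInt a L (m + 1) y = a y * fredInt L (m + 1) -
      (m + 1) * ∫ u, L u y * borderedInt a L m u ∂halfLine := by
  have hc : Continuous fun u => L u y := h.continuous_kernel_comp continuous_id continuous_const
  have hb : ∀ u, |L u y| ≤ (C * Real.exp (-y)) * Real.exp (-u) := fun u =>
    (h.bound_kernel u y).trans_eq (by ring)
  rw [← h.integral_sum_mul_borderedDet hc hb, borderedInt, fredInt, ← integral_const_mul,
    ← integral_sub]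
  · simp only [borderedDet_cons]
  · exact (h.integrable_fredDet _).const_mul _
  · exact integrable_finsetSum _ fun i _ => h.integrable_mul_borderedDet hc hb m i

end DecayData

lemma fredholmDet1_eq_tsum (L : ℝ → ℝ → ℝ) :
    fredholmDet1 L = ∑' n : ℕ, (1 / (n.factorial : ℝ)) * fredInt L n := by
  simp only [fredholmDet1, restrict_forall_pos_eq, fredInt, fredDet]

lemma fredInt_zero (L : ℝ → ℝ → ℝ) : fredInt L 0 = 1 := by
  simp [fredInt, fredDet, Measure.real]

/-- The sum of the bordered Fredholm series. -/
noncomputable def borderedSum (a : ℝ → ℝ) (L : ℝ → ℝ → ℝ) (y : ℝ) : ℝ :=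
  ∑' m : ℕ, (1 / (m.factorial : ℝ)) * borderedInt a L m y

lemma integrable_exp_neg_mul_exp_neg :
    Integrable (fun u => Real.exp (-u) * Real.exp (-u)) halfLine := by
  refine integrable_exp_neg_two_halfLine.congr (ae_of_all _ fun u => ?_)
  simp only [← Real.exp_add]; ring_nf

lemma integral_exp_neg_mul_exp_neg :
    ∫ u, Real.exp (-u) * Real.exp (-u) ∂halfLine = 1 / 2 := by
  simp only [← Real.exp_add, ← two_mul, mul_neg, ← neg_mul]
  rw [integral_exp_mul_Ioi (by norm_num)]; norm_num

namespace DecayData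

variable {a : ℝ → ℝ} {L : ℝ → ℝ → ℝ} {C : ℝ}

lemma norm_borderedInt_term_le (h : DecayData a L C) (m : ℕ) (y : ℝ) :
    ‖(1 / (m.factorial : ℝ)) * borderedInt a L m y‖ ≤
      (1 / (m.factorial : ℝ)) * (C ^ (m + 1) * hadamardFactor (m + 1)) * Real.exp (-y) := by
  rw [norm_mul, Real.norm_of_nonneg (by positivity), mul_assoc]
  exact mul_le_mul_of_nonneg_left (h.abs_borderedInt_le m y) (by positivity)

lemma summable_fredInt (h : DecayData a L C) :
    Summable fun n : ℕ => (1 / (n.factorial : ℝ)) * fredInt L n := by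
  refine (summable_hadamardFactor h.pos.le).of_norm_bounded fun n => ?_
  rw [norm_mul, Real.norm_of_nonneg (by positivity)]
  exact mul_le_mul_of_nonneg_left (h.abs_fredInt_le n) (by positivity)

lemma summable_borderedInt (h : DecayData a L C) (y : ℝ) :
    Summable fun m : ℕ => (1 / (m.factorial : ℝ)) * borderedInt a L m y :=
  ((summable_hadamardFactor_succ h.pos.le).mul_right _).of_norm_bounded fun m =>
    h.norm_borderedInt_term_le m y

lemma exists_borderedSum_bound (h : DecayData a L C) :
    ∃ D, ∀ y, |borderedSum a L y| ≤ D * Real.exp (-y) :=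
  ⟨_, fun y => tsum_of_norm_bounded ((summable_hadamardFactor_succ h.pos.le).hasSum.mul_right _)
    fun m => h.norm_borderedInt_term_le m y⟩

lemma stronglyMeasurable_borderedSum (h : DecayData a L C) :
    StronglyMeasurable (borderedSum a L) := by
  refine stronglyMeasurable_of_tendsto atTop
    (f := fun n y => ∑ m ∈ Finset.range n, (1 / (m.factorial : ℝ)) * borderedInt a L m y)
    (fun n => ?_) (tendsto_pi_nhds.2 fun y => (h.summable_borderedInt y).hasSum.tendsto_sum_nat)
  exact Finset.stronglyMeasurable_fun_sum _ fun m _ =>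
    (h.stronglyMeasurable_borderedInt m).const_mul _

lemma hasSum_integral_mul_borderedInt (h : DecayData a L C) {φ : ℝ → ℝ} {D : ℝ}
    (hφc : Continuous φ) (hφ : ∀ u, |φ u| ≤ D * Real.exp (-u)) :
    HasSum (fun m : ℕ => (1 / (m.factorial : ℝ)) * ∫ u, φ u * borderedInt a L m u ∂halfLine)
      (∫ u, φ u * borderedSum a L u ∂halfLine) := by
  have hbd : ∀ (m : ℕ) u, ‖φ u * ((1 / (m.factorial : ℝ)) * borderedInt a L m u)‖ ≤
      D * ((1 / (m.factorial : ℝ)) * (C ^ (m + 1) * hadamardFactor (m + 1))) *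
        (Real.exp (-u) * Real.exp (-u)) := fun m u => by
    rw [norm_mul]
    refine (mul_le_mul (hφ u) (h.norm_borderedInt_term_le m u) (norm_nonneg _)
      ((abs_nonneg _).trans (hφ u))).trans_eq (by ring)
  have hint : ∀ m : ℕ, Integrable
      (fun u => φ u * ((1 / (m.factorial : ℝ)) * borderedInt a L m u)) halfLine := fun m =>
    (integrable_exp_neg_mul_exp_neg.const_mul _).mono'
      (hφc.aestronglyMeasurable.mul
        ((h.stronglyMeasurable_borderedInt m).const_mul _).aestronglyMeasurable)
      (ae_of_all _ fun u => hbd m u)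
  have hD : 0 ≤ D := by
    have := (abs_nonneg _).trans (hφ 0)
    simpa using this
  have hsum : Summable fun m : ℕ =>
      ∫ u, ‖φ u * ((1 / (m.factorial : ℝ)) * borderedInt a L m u)‖ ∂halfLine := by
    refine Summable.of_nonneg_of_le (fun m => integral_nonneg fun _ => norm_nonneg _) (fun m => ?_)
      (((summable_hadamardFactor_succ h.pos.le).mul_left D).mul_right (1 / 2))
    refine (integral_mono (hint m).norm (integrable_exp_neg_mul_exp_neg.const_mul _)
      (hbd m)).trans_eq ?_
    rw [integral_const_mul, integral_exp_neg_mul_exp_neg]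
  have key := hasSum_integral_of_summable_integral_norm hint hsum
  simp only [tsum_mul_left] at key
  simp only [mul_left_comm (φ _) (1 / _), integral_const_mul] at key
  exact key

lemma borderedSum_eq (h : DecayData a L C) (y : ℝ) :
    borderedSum a L y = a y * fredholmDet1 L - ∫ u, L u y * borderedSum a L u ∂halfLine := by
  have hc : Continuous fun u => L u y := h.continuous_kernel_comp continuous_id continuous_const
  have hb : ∀ u, |L u y| ≤ (C * Real.exp (-y)) * Real.exp (-u) := fun u =>
    (h.bound_kernel u y).trans_eq (by ring)
  have hs := h.hasSum_integral_mul_borderedInt hc hb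
  have hf := (summable_nat_add_iff 1).2 h.summable_fredInt
  rw [borderedSum, (h.summable_borderedInt y).tsum_eq_zero_add, borderedInt_zero,
    fredholmDet1_eq_tsum, h.summable_fredInt.tsum_eq_zero_add, fredInt_zero, ← hs.tsum_eq,
    mul_add, ← tsum_mul_left, add_sub_assoc, ← (hf.mul_left (a y)).tsum_sub hs.summable]
  congr 1
  · simp
  · refine tsum_congr fun m => ?_
    rw [h.borderedInt_succ, Nat.factorial_succ]
    push_cast
    field_simp

end DecayData

lemma hasDerivAt_fredInt_succ {a : ℝ → ℝ → ℝ} {L : ℝ → ℝ → ℝ → ℝ} {C ξ : ℝ} {s : Set ℝ}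
    (hs : s ∈ 𝓝 ξ) (h : ∀ t ∈ s, DecayData (a t) (L t) C)
    (hL : ∀ t ∈ s, ∀ x y, HasDerivAt (fun t => L t x y) (a t x * a t y) t) (n : ℕ) :
    HasDerivAt (fun t => fredInt (L t) (n + 1))
      ((n + 1) * ∫ u, a ξ u * borderedInt (a ξ) (L ξ) n u ∂halfLine) ξ := by
  have hξ := h ξ (mem_of_mem_nhds hs)
  rw [← hξ.integral_sum_mul_borderedDet hξ.continuous_fun hξ.bound_fun n]
  refine (hasDerivAt_integral_of_dominated_loc_of_deriv_le
    (F := fun t z => fredDet (L t) (n + 1) z)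
    (F' := fun t z => ∑ i : Fin (n + 1), a t (z i) *
      borderedDet (a t) (L t) n (z ∘ i.cycleRange.symm))
    (bound := fun z => ∑ _i : Fin (n + 1), C * (C ^ (n + 1) * hadamardFactor (n + 1)) *
      fredWeight (n + 1) z) hs ?_ (hξ.integrable_fredDet _) ?_ ?_ ?_ ?_).2
  · filter_upwards [hs] with t ht using ((h t ht).continuous_fredDet _).aestronglyMeasurable
  · exact (integrable_finsetSum _ fun i _ =>
      hξ.integrable_mul_borderedDet hξ.continuous_fun hξ.bound_fun n i).aestronglyMeasurable
  · refine ae_of_all _ fun z t ht => ?_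
    exact norm_sum_le_of_le _ fun i _ =>
      (h t ht).abs_mul_borderedDet_comp_perm_le (h t ht).bound_fun n i z
  · exact integrable_finsetSum _ fun i _ => (integrable_fredWeight _).const_mul _
  · exact ae_of_all _ fun z t ht => hasDerivAt_fredDet z (hL t ht)

lemma hasDerivAt_fredholmDet1 {a : ℝ → ℝ → ℝ} {L : ℝ → ℝ → ℝ → ℝ} {C ξ : ℝ} {s : Set ℝ}
    (hso : IsOpen s) (hsc : IsPreconnected s) (hξs : ξ ∈ s)
    (h : ∀ t ∈ s, DecayData (a t) (L t) C)
    (hL : ∀ t ∈ s, ∀ x y, HasDerivAt (fun t => L t x y) (a t x * a t y) t) :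
    HasDerivAt (fun t => fredholmDet1 (L t))
      (∫ u, a ξ u * borderedSum (a ξ) (L ξ) u ∂halfLine) ξ := by
  have hξ := h ξ hξs
  have hn := hξ.hasSum_integral_mul_borderedInt hξ.continuous_fun hξ.bound_fun
  have hfac : ∀ n : ℕ, (1 / ((n + 1).factorial : ℝ)) * (n + 1) = 1 / (n.factorial : ℝ) := fun n => by
    rw [Nat.factorial_succ]; push_cast; field_simp
  have key := hasDerivAt_tsum_of_isPreconnected
    (g := fun (n : ℕ) t => (1 / ((n + 1).factorial : ℝ)) * fredInt (L t) (n + 1))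
    (g' := fun (n : ℕ) t => (1 / ((n + 1).factorial : ℝ)) *
      ((n + 1) * ∫ u, a t u * borderedInt (a t) (L t) n u ∂halfLine))
    (u := fun n : ℕ => C * ((1 / (n.factorial : ℝ)) * (C ^ (n + 1) * hadamardFactor (n + 1))))
    ((summable_hadamardFactor_succ hξ.pos.le).mul_left C) hso hsc
    (fun n t ht => (hasDerivAt_fredInt_succ (hso.mem_nhds ht) h hL n).const_mul _)
    (fun n t ht => ?_) hξs ((summable_nat_add_iff 1).2 hξ.summable_fredInt) hξs
  · simp only [← mul_assoc, hfac] at key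
    rw [hn.tsum_eq] at key
    refine (key.const_add 1).congr_of_eventuallyEq ?_
    filter_upwards [hso.mem_nhds hξs] with t ht
    rw [fredholmDet1_eq_tsum, (h t ht).summable_fredInt.tsum_eq_zero_add, fredInt_zero]
    simp
  · have ht' := h t ht
    have hC := ht'.pos
    have hh := hadamardFactor_nonneg (n + 1)
    rw [← mul_assoc, hfac, norm_mul, Real.norm_of_nonneg (by positivity), mul_left_comm]
    refine mul_le_mul_of_nonneg_left ?_ (by positivity)
    refine (norm_integral_le_of_norm_le (integrable_exp_neg_mul_exp_neg.const_mul
      (C * (C ^ (n + 1) * hadamardFactor (n + 1)))) (ae_of_all _ fun u => ?_)).trans ?_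
    · rw [norm_mul]
      refine (mul_le_mul (ht'.bound_fun u) (ht'.abs_borderedInt_le n u) (abs_nonneg _)
        (by positivity)).trans_eq (by ring)
    · rw [integral_const_mul, integral_exp_neg_mul_exp_neg]
      have : 0 ≤ C * (C ^ (n + 1) * hadamardFactor (n + 1)) := by positivity
      linarith

/-- Measurability and exponential decay on `(0, ∞)`. -/
def HalfLineDecay (f : ℝ → ℝ) : Prop :=
  AEStronglyMeasurable f halfLine ∧ ∃ C, ∀ w, 0 < w → |f w| ≤ C * Real.exp (-w / 2)

lemma integrable_exp_neg_halfLine : Integrable (fun w : ℝ => Real.exp (-w)) halfLine := by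
  simpa [IntegrableOn] using integrableOn_exp_mul_Ioi (a := -1) (by norm_num) 0

lemma HalfLineDecay.integrable_mul {f g : ℝ → ℝ} (hf : HalfLineDecay f) (hg : HalfLineDecay g) :
    Integrable (fun w => f w * g w) halfLine := by
  obtain ⟨hf, C, hC⟩ := hf
  obtain ⟨hg, D, hD⟩ := hg
  refine (integrable_exp_neg_halfLine.const_mul (C * D)).mono' (hf.mul hg)
    ((ae_restrict_iff' measurableSet_Ioi).2 (ae_of_all _ fun w hw => ?_))
  rw [norm_mul]
  refine (mul_le_mul (hC w hw) (hD w hw) (abs_nonneg _)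
    ((abs_nonneg _).trans (hC w hw))).trans_eq ?_
  rw [mul_mul_mul_comm, ← Real.exp_add, ← add_div]
  ring_nf

lemma HalfLineDecay.of_le {f : ℝ → ℝ} {C : ℝ} (hf : StronglyMeasurable f)
    (h : ∀ w, |f w| ≤ C * Real.exp (-w)) : HalfLineDecay f := by
  refine ⟨hf.aestronglyMeasurable, C, fun w hw => (h w).trans ?_⟩
  have hC : 0 ≤ C := by simpa using (abs_nonneg _).trans (h 0)
  gcongr
  linarith

section pairing

variable {a : ℝ → ℝ} {K : ℝ → ℝ → ℝ} {C : ℝ}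

lemma DecayData.halfLineDecay_kernel (hK : DecayData a K C) (y : ℝ) :
    HalfLineDecay fun w => K w y :=
  .of_le (C := C * Real.exp (-y))
    (hK.continuous_kernel_comp continuous_id continuous_const).stronglyMeasurable
    fun w => (hK.bound_kernel w y).trans_eq (by ring)

lemma DecayData.integral_mul_integral_kernel (hK : DecayData a K C)
    (hsymm : ∀ x y, K x y = K y x) {f g : ℝ → ℝ} (hf : HalfLineDecay f) (hg : HalfLineDecay g) :
    ∫ w, f w * ∫ l, K w l * g l ∂halfLine ∂halfLine =
      ∫ w, (∫ l, K w l * f l ∂halfLine) * g w ∂halfLine := by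
  obtain ⟨hf, Cf, hCf⟩ := hf
  obtain ⟨hg, Cg, hCg⟩ := hg
  have hpos : ∀ᵐ p : ℝ × ℝ ∂halfLine.prod halfLine, 0 < p.1 ∧ 0 < p.2 := by
    rw [Measure.prod_restrict]
    exact (ae_restrict_iff' (measurableSet_Ioi.prod measurableSet_Ioi)).2
      (ae_of_all _ fun p hp => hp)
  have hint : Integrable (fun p : ℝ × ℝ => f p.1 * (K p.1 p.2 * g p.2))
      (halfLine.prod halfLine) := by
    refine ((integrable_exp_neg_halfLine.mul_prod integrable_exp_neg_halfLine).const_mul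
      (Cf * (C * Cg))).mono' (hf.comp_fst.mul
      (hK.continuous_kernel.aestronglyMeasurable.mul hg.comp_snd)) ?_
    filter_upwards [hpos] with p hp
    have h1 := hCf _ hp.1
    have h2 := hCg _ hp.2
    have h3 := hK.bound_kernel p.1 p.2
    have hCf0 : 0 ≤ Cf := nonneg_of_mul_nonneg_left ((abs_nonneg _).trans h1) (Real.exp_pos _)
    have hCg0 : 0 ≤ Cg := nonneg_of_mul_nonneg_left ((abs_nonneg _).trans h2) (Real.exp_pos _)
    have hC := hK.pos
    have e1 : Real.exp (-p.1 / 2) ≤ 1 := Real.exp_le_one_iff.2 (by linarith [hp.1])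
    have e2 : Real.exp (-p.2 / 2) ≤ 1 := Real.exp_le_one_iff.2 (by linarith [hp.2])
    rw [norm_mul, norm_mul]
    calc |f p.1| * (|K p.1 p.2| * |g p.2|)
        ≤ (Cf * 1) * ((C * (Real.exp (-p.1) * Real.exp (-p.2))) * (Cg * 1)) := by
          gcongr
          · exact h1.trans (by gcongr)
          · exact h2.trans (by gcongr)
      _ = _ := by ring
  have hsw := integral_integral_swap (f := fun w l => f w * (K w l * g l)) hint
  simp only [integral_const_mul] at hsw
  rw [hsw]
  refine integral_congr_ae (ae_of_all _ fun l => ?_)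
  simp only
  rw [← integral_mul_const]
  refine integral_congr_ae (ae_of_all _ fun w => ?_)
  simp only [hsymm l w]
  ring

lemma DecayData.integral_pairing (hK : DecayData a K C) (hsymm : ∀ x y, K x y = K y x)
    {f g p q : ℝ → ℝ} (hf : HalfLineDecay f) (hg : HalfLineDecay g) (hp : HalfLineDecay p)
    (hq : HalfLineDecay q) (hfp : ∀ w, 0 < w → f w = p w + ∫ l, K w l * f l ∂halfLine)
    (hgq : ∀ w, 0 < w → g w = q w + ∫ l, K w l * g l ∂halfLine) :
    ∫ w, f w * q w ∂halfLine = ∫ w, p w * g w ∂halfLine := by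
  have h := hK.integral_mul_integral_kernel hsymm hf hg
  have e1 : ∫ w, f w * ∫ l, K w l * g l ∂halfLine ∂halfLine =
      (∫ w, f w * g w ∂halfLine) - ∫ w, f w * q w ∂halfLine := by
    rw [← integral_sub (hf.integrable_mul hg) (hf.integrable_mul hq)]
    refine setIntegral_congr_fun measurableSet_Ioi fun w hw => ?_
    have := hgq w hw
    linear_combination (-f w) * this
  have e2 : ∫ w, (∫ l, K w l * f l ∂halfLine) * g w ∂halfLine =
      (∫ w, f w * g w ∂halfLine) - ∫ w, p w * g w ∂halfLine := by
    rw [← integral_sub (hf.integrable_mul hg) (hp.integrable_mul hg)]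
    refine setIntegral_congr_fun measurableSet_Ioi fun w hw => ?_
    have := hfp w hw
    linear_combination (-g w) * this
  linarith

/-- A solution of `G = F a + K G` is computed by any decaying resolvent kernel `R = K + K R`. -/
lemma DecayData.mul_trace_resolvent_eq (hK : DecayData a K C) (hsymm : ∀ x y, K x y = K y x)
    {R : ℝ → ℝ → ℝ} (hR : ∀ w y, 0 < w → R w y = K w y + ∫ l, K w l * R l y ∂halfLine)
    (hRd : ∀ y, HalfLineDecay fun w => R w y) {G : ℝ → ℝ} {F : ℝ} (hG : HalfLineDecay G)
    (hGe : ∀ w, G w = F * a w + ∫ l, K w l * G l ∂halfLine) :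
    F * ((∫ w, a w * a w ∂halfLine) +
      ∫ w, ∫ l, R w l * a l * a w ∂halfLine ∂halfLine) = ∫ w, a w * G w ∂halfLine := by
  have ha : HalfLineDecay a := .of_le hK.continuous_fun.stronglyMeasurable hK.bound_fun
  have hFa : HalfLineDecay fun w => F * a w :=
    .of_le (C := |F| * C) (hK.continuous_fun.stronglyMeasurable.const_mul F) fun w => by
      rw [abs_mul, mul_assoc]; exact mul_le_mul_of_nonneg_left (hK.bound_fun w) (abs_nonneg _)
  have hRs : ∀ x y, 0 < x → 0 < y → R x y = R y x := fun x y hx hy => by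
    have h := hK.integral_pairing hsymm (hRd x) (hRd y) (hK.halfLineDecay_kernel x)
      (hK.halfLineDecay_kernel y) (fun w hw => hR w x hw) (fun w hw => hR w y hw)
    rw [hR x y hx, hR y x hy, hsymm x y]
    congr 1
    calc _ = ∫ w, K w x * R w y ∂halfLine := by simp only [hsymm x]
      _ = _ := by rw [← h]; simp only [hsymm y, mul_comm]
  have hI : ∀ y, F * ∫ w, R w y * a w ∂halfLine = G y - F * a y := fun y => by
    have h := hK.integral_pairing hsymm (hRd y) hG (hK.halfLineDecay_kernel y) hFa
      (fun w hw => hR w y hw) (fun w _ => hGe w)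
    rw [hGe y, add_sub_cancel_left, ← integral_const_mul]
    calc _ = ∫ w, R w y * (F * a w) ∂halfLine := by congr 1 with w; ring
      _ = _ := by rw [h]; simp only [hsymm y]
  rw [mul_add, ← integral_const_mul, ← integral_const_mul,
    add_comm, ← eq_sub_iff_add_eq, ← integral_sub (ha.integrable_mul hG) ((ha.integrable_mul ha).const_mul F)]
  refine setIntegral_congr_fun measurableSet_Ioi fun w hw => ?_
  have h1 : ∫ l, R w l * a l * a w ∂halfLine = (∫ l, R l w * a l ∂halfLine) * a w := by
    rw [← integral_mul_const]
    refine setIntegral_congr_fun measurableSet_Ioi fun l hl => ?_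
    simp only [hRs w l hw hl]
  rw [h1]
  linear_combination (a w) * hI w

end pairing

lemma exists_decayData_airy (ξ : ℝ) :
    ∃ C, ∀ t ∈ Ioo (ξ - 1) (ξ + 1), DecayData (fun x => Ai (t + x))
      (fun x y => -KAi t x y) C := by
  obtain ⟨C₁, hC₁, h₁⟩ := exists_Ai_bound
  obtain ⟨C₂, hC₂, h₂⟩ := exists_airyKer_bound
  refine ⟨C₁ * Real.exp (1 - ξ) + C₂ * Real.exp (2 * (1 - ξ)), fun t ht => ?_⟩
  have hp := mul_pos hC₁ (Real.exp_pos (1 - ξ))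
  have hq := mul_pos hC₂ (Real.exp_pos (2 * (1 - ξ)))
  refine ⟨by positivity, continuous_Ai.comp (continuous_const_add t), ?_, fun x => ?_, fun x y => ?_⟩
  · have h : Continuous fun p : ℝ × ℝ => (t + p.1, t + p.2) := by fun_prop
    have h2 := continuous_airyKer.comp h
    simp only [Function.comp_def] at h2
    exact h2.neg
  · calc |Ai (t + x)| ≤ C₁ * Real.exp (-(t + x)) := (h₁ _).1
      _ ≤ C₁ * (Real.exp (1 - ξ) * Real.exp (-x)) := by
        rw [← Real.exp_add]; gcongr; linarith [ht.1]
      _ ≤ _ := by rw [← mul_assoc]; gcongr; linarith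
  · rw [abs_neg, KAi_eq]
    calc _ ≤ C₂ * Real.exp (-(t + x) - (t + y)) := h₂ _ _
      _ ≤ C₂ * (Real.exp (2 * (1 - ξ)) * (Real.exp (-x) * Real.exp (-y))) := by
        rw [← Real.exp_add, ← Real.exp_add]; gcongr; linarith [ht.1]
      _ ≤ _ := by rw [← mul_assoc]; gcongr; linarith

/-- `∂/∂ξ K_{Ai,ξ}(v₁,v₂) = −Ai(ξ+v₁)Ai(ξ+v₂)`, and consequently
`F₂'(ξ) = F₂(ξ)·tr((I−K_{Ai,ξ})⁻¹ Ai_ξ ⊗ Ai_ξ)`, where the trace of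
`(I−K)⁻¹ (Ai_ξ ⊗ Ai_ξ) = (I+R)(Ai_ξ ⊗ Ai_ξ)` is expressed via the resolvent kernel `R`
satisfying `R = K + K∘R`. -/
theorem airy_kernel_deriv_and_tracy_widom (ξ v₁ v₂ : ℝ) (R : ℝ → ℝ → ℝ)
    (hR : ∀ w₁ w₂ : ℝ, R w₁ w₂ = KAi ξ w₁ w₂ + kComp (KAi ξ) R w₁ w₂) :
    HasDerivAt (fun x => KAi x v₁ v₂) (-(Ai (ξ + v₁) * Ai (ξ + v₂))) ξ ∧
      HasDerivAt F₂
        (F₂ ξ * ((∫ v in Set.Ioi (0 : ℝ), Ai (ξ + v) * Ai (ξ + v)) +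
          ∫ w₁ in Set.Ioi (0 : ℝ), ∫ w₂ in Set.Ioi (0 : ℝ),
            R w₁ w₂ * Ai (ξ + w₂) * Ai (ξ + w₁))) ξ := by
  refine ⟨hasDerivAt_KAi ξ v₁ v₂, ?_⟩
  obtain ⟨C, hC⟩ := exists_decayData_airy ξ
  have hξ : ξ ∈ Ioo (ξ - 1) (ξ + 1) := ⟨by linarith, by linarith⟩
  have hD := hC ξ hξ
  have hK : DecayData (fun x => Ai (ξ + x)) (KAi ξ) C :=
    ⟨hD.pos, hD.continuous_fun, by
      simpa only [neg_neg] using hD.continuous_kernel.fun_neg, hD.bound_fun,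
      fun x y => by simpa using hD.bound_kernel x y⟩
  have hsymm : ∀ x y, KAi ξ x y = KAi ξ y x := fun x y => by
    rw [KAi_eq, KAi_eq, airyKer_symm]
  obtain ⟨D, hGD⟩ := hD.exists_borderedSum_bound
  have key := hK.mul_trace_resolvent_eq hsymm (R := R) (fun w y _ => hR w y)
    (fun y => resolvent_section_regular ξ y fun w _ => hR w y)
    (.of_le hD.stronglyMeasurable_borderedSum hGD) (F := F₂ ξ) fun w => by
      rw [hD.borderedSum_eq w, F₂, mul_comm, sub_eq_add_neg, ← integral_neg]
      simp only [neg_mul, neg_neg, hsymm w]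
  refine HasDerivAt.congr_deriv (f := F₂) (hasDerivAt_fredholmDet1
    (a := fun t x => Ai (t + x)) (L := fun t x y => -KAi t x y) isOpen_Ioo isPreconnected_Ioo hξ hC
    fun t _ x y => ?_) key.symm
  simpa only [neg_neg] using (hasDerivAt_KAi t x y).fun_neg
end
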